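/- arXiv:1510.04926 — 4 statements merged into one kernel-verified Lean document; each statement's English description precedes it below -/
import Mathlib

section
/- Let ω be an oscillation function that is concave on [0, R], and let ω₁ be an oscillation function with ω₁ << ω (i.e. lim_{r→0} ω₁(r)/ω(r) = 0). Let K be a closed ball of radius δ ≤ R/2 centered at the origin in ℝⁿ and define f(x) = ω(|x|) for x ∈ K. Then f ∈ D_ω(K), and for every g ∈ D_{ω₁}(K) one has [f − g]_ω ≥ 1. Consequently D_{ω₁}(K) is not dense in D_ω(K). -/
open Set Metric MeasureTheory Filter Topology

/-- The oscillation `ω_f(r)` of `f` over `K` at scale `r`. -/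
noncomputable def oscf {n : ℕ} (K : Set (EuclideanSpace ℝ (Fin n)))
    (f : EuclideanSpace ℝ (Fin n) → ℝ) (r : ℝ) : ℝ :=
  sSup {d : ℝ | ∃ x ∈ K, ∃ y ∈ K, 0 < dist x y ∧ dist x y ≤ r ∧ d = |f x - f y|}

/-- The set of quotients `ω_f(r)/ω(r)`, `0 < r < R`, whose supremum is the seminorm `[f]_ω`. -/
def semiSet {n : ℕ} (K : Set (EuclideanSpace ℝ (Fin n))) (ω : ℝ → ℝ) (R : ℝ)
    (f : EuclideanSpace ℝ (Fin n) → ℝ) : Set ℝ :=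
  {c : ℝ | ∃ r ∈ Set.Ioo (0 : ℝ) R, c = oscf K f r / ω r}

/-- The seminorm `[f]_ω = sup_{0<r<R} ω_f(r)/ω(r)`. -/
noncomputable def domSemi {n : ℕ} (K : Set (EuclideanSpace ℝ (Fin n))) (ω : ℝ → ℝ) (R : ℝ)
    (f : EuclideanSpace ℝ (Fin n) → ℝ) : ℝ :=
  sSup (semiSet K ω R f)

/-- The sup norm `‖f‖` on `K`. -/
noncomputable def supNorm {n : ℕ} (K : Set (EuclideanSpace ℝ (Fin n)))
    (f : EuclideanSpace ℝ (Fin n) → ℝ) : ℝ :=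
  sSup {d : ℝ | ∃ x ∈ K, d = |f x|}

/-- Membership in the space `D_ω(K)`: `f` is continuous on `K` and `[f]_ω < ∞`. -/
def MemD {n : ℕ} (K : Set (EuclideanSpace ℝ (Fin n))) (ω : ℝ → ℝ) (R : ℝ)
    (f : EuclideanSpace ℝ (Fin n) → ℝ) : Prop :=
  ContinuousOn f K ∧ BddAbove (semiSet K ω R f)

/-- The norm `‖f‖_ω = [f]_ω + ‖f‖` on `D_ω(K)`. -/
noncomputable def domNorm {n : ℕ} (K : Set (EuclideanSpace ℝ (Fin n))) (ω : ℝ → ℝ) (R : ℝ)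
    (f : EuclideanSpace ℝ (Fin n) → ℝ) : ℝ :=
  domSemi K ω R f + supNorm K f

/-- An oscillation function on `[0,R]`: continuous, non-decreasing, `ω(0)=0`, `ω(r)>0` for `r>0`. -/
structure IsOsc (ω : ℝ → ℝ) (R : ℝ) : Prop where
  cont : ContinuousOn ω (Set.Icc 0 R)
  mono : MonotoneOn ω (Set.Icc 0 R)
  zero : ω 0 = 0
  pos : ∀ r : ℝ, 0 < r → r ≤ R → 0 < ω r

section Oscillation

variable {n : ℕ} {K : Set (EuclideanSpace ℝ (Fin n))} {f : EuclideanSpace ℝ (Fin n) → ℝ}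

theorem oscf_le {r c : ℝ} (hc : 0 ≤ c)
    (h : ∀ x ∈ K, ∀ y ∈ K, dist x y ≤ r → |f x - f y| ≤ c) : oscf K f r ≤ c := by
  refine Real.sSup_le ?_ hc
  rintro d ⟨x, hx, y, hy, -, hxy, rfl⟩
  exact h x hx y hy hxy

theorem abs_sub_le_oscf (hK : IsCompact K) (hf : ContinuousOn f K) {r : ℝ}
    {x y : EuclideanSpace ℝ (Fin n)} (hx : x ∈ K) (hy : y ∈ K) (hxy : dist x y ≤ r)
    (hne : 0 < dist x y) : |f x - f y| ≤ oscf K f r := by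
  obtain ⟨C, hC⟩ := hK.exists_bound_of_continuousOn hf
  refine le_csSup ⟨C + C, ?_⟩ ⟨x, hx, y, hy, hne, hxy, rfl⟩
  rintro d ⟨u, hu, v, hv, -, -, rfl⟩
  exact (abs_sub _ _).trans (add_le_add (hC u hu) (hC v hv))

theorem exists_abs_sub_le_of_memD (hK : IsCompact K) {ω : ℝ → ℝ} {R : ℝ} (hω : IsOsc ω R)
    (hf : MemD K ω R f) :
    ∃ M, 0 ≤ M ∧ ∀ r ∈ Ioo 0 R, ∀ x ∈ K, ∀ y ∈ K, dist x y ≤ r → |f x - f y| ≤ M * ω r := by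
  obtain ⟨hc, M, hM⟩ := hf
  refine ⟨max M 0, le_max_right _ _, fun r hr x hx y hy hxy => ?_⟩
  have hpos := hω.pos r hr.1 hr.2.le
  rcases (dist_nonneg (x := x) (y := y)).eq_or_lt with h0 | h0
  · rw [dist_eq_zero.1 h0.symm, sub_self, abs_zero]
    positivity
  · have h1 : oscf K f r / ω r ≤ max M 0 := (hM ⟨r, hr, rfl⟩).trans (le_max_left _ _)
    exact (abs_sub_le_oscf hK hc hx hy hxy h0).trans ((div_le_iff₀ hpos).1 h1)

end Oscillation

theorem IsOsc.exists_div_le {ω ω₁ : ℝ → ℝ} {R : ℝ} (hω : IsOsc ω R) (hω₁ : IsOsc ω₁ R)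
    (hll : Tendsto (fun r => ω₁ r / ω r) (𝓝[>] 0) (𝓝 0)) :
    ∃ C, ∀ r ∈ Ioo 0 R, ω₁ r / ω r ≤ C := by
  obtain ⟨ε, hε, h⟩ := mem_nhdsGT_iff_exists_Ioo_subset.1 (hll.eventually_le_const one_pos)
  refine ⟨max 1 (ω₁ R / ω ε), fun r hr => ?_⟩
  rcases lt_or_ge r ε with hrε | hrε
  · exact le_max_of_le_left (h ⟨hr.1, hrε⟩)
  · have hε0 : 0 < ε := hε
    have hR : 0 < R := hr.1.trans hr.2
    have hεR : ε ≤ R := hrε.trans hr.2.le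
    exact le_max_of_le_right (div_le_div₀ (hω₁.pos R hR le_rfl).le
      (hω₁.mono ⟨hr.1.le, hr.2.le⟩ ⟨hR.le, le_rfl⟩ hr.2.le) (hω.pos ε hε0 hεR)
      (hω.mono ⟨hε0.le, hεR⟩ ⟨hr.1.le, hr.2.le⟩ hrε))

theorem IsOsc.sub_le_of_concaveOn {ω : ℝ → ℝ} {R : ℝ} (hω : IsOsc ω R)
    (hconc : ConcaveOn ℝ (Icc 0 R) ω) {a b : ℝ} (ha : 0 ≤ a) (hab : a ≤ b) (hb : b ≤ R) :
    ω b - ω a ≤ ω (b - a) := by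
  rcases (ha.trans hab).eq_or_lt with h0 | hb0
  · obtain rfl : a = 0 := le_antisymm (hab.trans h0.ge) ha
    simp [hω.zero]
  · have key : ∀ t, 0 ≤ t → t ≤ b → t / b * ω b ≤ ω t := fun t ht htb => by
      have := hconc.2 (⟨hb0.le, hb⟩ : b ∈ Icc 0 R) (⟨le_rfl, hb0.le.trans hb⟩ : 0 ∈ Icc 0 R)
        (div_nonneg ht hb0.le) (sub_nonneg.2 ((div_le_one hb0).2 htb))
        (add_sub_cancel (t / b) 1)
      simpa [hω.zero, div_mul_cancel₀ t hb0.ne'] using this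
    have h1 := key a ha hab
    have h2 := key (b - a) (sub_nonneg.2 hab) (sub_le_self b ha)
    have h3 : a / b * ω b + (b - a) / b * ω b = ω b := by field_simp; ring
    linarith

theorem IsOsc.abs_sub_norm_le {E : Type*} [SeminormedAddCommGroup E] {ω : ℝ → ℝ} {R : ℝ}
    (hω : IsOsc ω R) (hconc : ConcaveOn ℝ (Icc 0 R) ω) {x y : E} (hx : ‖x‖ ≤ R) (hy : ‖y‖ ≤ R)
    {r : ℝ} (hr : r ≤ R) (hxy : dist x y ≤ r) : |ω ‖x‖ - ω ‖y‖| ≤ ω r := by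
  wlog hle : ‖y‖ ≤ ‖x‖ generalizing x y
  · rw [abs_sub_comm]
    exact this hy hx (by rwa [dist_comm]) (le_of_not_ge hle)
  have hd : ‖x‖ - ‖y‖ ≤ r := (norm_sub_norm_le x y).trans (by rwa [← dist_eq_norm])
  rw [abs_of_nonneg (sub_nonneg.2
    (hω.mono ⟨norm_nonneg _, hy⟩ ⟨norm_nonneg _, hx⟩ hle))]
  have h0 : 0 ≤ ‖x‖ - ‖y‖ := sub_nonneg.2 hle
  exact (hω.sub_le_of_concaveOn hconc (norm_nonneg _) hle hx).trans
    (hω.mono ⟨h0, hd.trans hr⟩ ⟨h0.trans hd, hr⟩ hd)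

/-- Non-density: if `ω` is concave and `ω₁ << ω`, then `f(x) = ω(|x|)` belongs to `D_ω(K)`
(`K` a closed ball of radius `δ ≤ R/2`), while `[f - g]_ω ≥ 1` for every `g ∈ D_{ω₁}(K)`;
consequently `D_{ω₁}(K)` is not dense in `D_ω(K)`. -/
theorem not_dense_of_littleO {n : ℕ} (hn : 1 ≤ n) (R δ : ℝ) (hR : 0 < R)
    (hδ : 0 < δ) (hδR : δ ≤ R / 2) (ω ω₁ : ℝ → ℝ) (hω : IsOsc ω R) (hω₁ : IsOsc ω₁ R)
    (hconc : ConcaveOn ℝ (Set.Icc 0 R) ω)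
    (hll : Filter.Tendsto (fun r => ω₁ r / ω r) (nhdsWithin 0 (Set.Ioi 0)) (nhds 0)) :
    MemD (Metric.closedBall (0 : EuclideanSpace ℝ (Fin n)) δ) ω R (fun x => ω ‖x‖) ∧
    (∀ g, MemD (Metric.closedBall (0 : EuclideanSpace ℝ (Fin n)) δ) ω₁ R g →
      1 ≤ domSemi (Metric.closedBall (0 : EuclideanSpace ℝ (Fin n)) δ) ω R
        (fun x => ω ‖x‖ - g x)) ∧
    ¬ ∃ g, MemD (Metric.closedBall (0 : EuclideanSpace ℝ (Fin n)) δ) ω₁ R g ∧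
        domNorm (Metric.closedBall (0 : EuclideanSpace ℝ (Fin n)) δ) ω R
          (fun x => ω ‖x‖ - g x) < 1 := by
  set K := Metric.closedBall (0 : EuclideanSpace ℝ (Fin n)) δ with hKdef
  have hK : IsCompact K := isCompact_closedBall _ _
  have hnorm : ∀ x ∈ K, ‖x‖ ≤ R := fun x hx => by
    have := mem_closedBall_zero_iff.1 hx
    linarith
  have hcont : ContinuousOn (fun x => ω ‖x‖) K :=
    hω.cont.comp continuous_norm.continuousOn fun x hx => ⟨norm_nonneg x, hnorm x hx⟩
  have hosc : ∀ r ∈ Ioo 0 R, ∀ x ∈ K, ∀ y ∈ K, dist x y ≤ r → |ω ‖x‖ - ω ‖y‖| ≤ ω r :=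
    fun r hr x hx y hy hxy =>
      hω.abs_sub_norm_le hconc (hnorm x hx) (hnorm y hy) hr.2.le hxy
  have hmain : ∀ g, MemD K ω₁ R g → 1 ≤ domSemi K ω R (fun x => ω ‖x‖ - g x) := by
    intro g hg
    obtain ⟨M, hM0, hM⟩ := exists_abs_sub_le_of_memD hK hω₁ hg
    obtain ⟨C, hC⟩ := hω.exists_div_le hω₁ hll
    have hbdd : BddAbove (semiSet K ω R (fun x => ω ‖x‖ - g x)) := by
      refine ⟨1 + M * C, ?_⟩
      rintro c ⟨r, hr, rfl⟩
      have hp := hω.pos r hr.1 hr.2.le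
      have hp₁ := hω₁.pos r hr.1 hr.2.le
      have h1 : oscf K (fun x => ω ‖x‖ - g x) r ≤ ω r + M * ω₁ r := by
        refine oscf_le (by positivity) fun x hx y hy hxy => ?_
        rw [sub_sub_sub_comm]
        exact (abs_sub _ _).trans (add_le_add (hosc r hr x hx y hy hxy) (hM r hr x hx y hy hxy))
      have h2 : M * ω₁ r ≤ M * (C * ω r) :=
        mul_le_mul_of_nonneg_left ((div_le_iff₀ hp).1 (hC r hr)) hM0
      rw [div_le_iff₀ hp]
      linarith
    have hlim : Tendsto (fun r => 1 - M * (ω₁ r / ω r)) (𝓝[>] 0) (𝓝 1) := by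
      simpa using (hll.const_mul M).const_sub 1
    refine le_of_tendsto hlim ?_
    filter_upwards [Ioo_mem_nhdsGT hδ] with r hr
    have hrR : r ∈ Ioo 0 R := ⟨hr.1, by linarith [hr.2]⟩
    have hp := hω.pos r hrR.1 hrR.2.le
    refine le_trans ?_ (le_csSup hbdd ⟨r, hrR, rfl⟩)
    set x : EuclideanSpace ℝ (Fin n) := EuclideanSpace.single ⟨0, hn⟩ r
    have hxn : ‖x‖ = r := by simp [x, abs_of_pos hr.1]
    have hx : x ∈ K := mem_closedBall_zero_iff.2 (hxn.le.trans hr.2.le)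
    have h0 : (0 : EuclideanSpace ℝ (Fin n)) ∈ K := mem_closedBall_self hδ.le
    have hd : dist x 0 = r := by rw [dist_zero_right, hxn]
    have h1 := abs_sub_le_oscf hK (hcont.sub hg.1) hx h0 hd.le (hd ▸ hr.1)
    have h2 := (abs_le.1 (hM r hrR x hx 0 h0 hd.le)).2
    have h3 : ω ‖x‖ - g x - (ω ‖(0 : EuclideanSpace ℝ (Fin n))‖ - g 0) ≤
        oscf K (fun x => ω ‖x‖ - g x) r := (le_abs_self _).trans h1
    rw [hxn, norm_zero, hω.zero] at h3
    rw [le_div_iff₀ hp, sub_mul, mul_assoc, div_mul_cancel₀ _ hp.ne']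
    linarith
  refine ⟨⟨hcont, 1, ?_⟩, hmain, ?_⟩
  · rintro c ⟨r, hr, rfl⟩
    have hp := hω.pos r hr.1 hr.2.le
    exact (div_le_one hp).2 (oscf_le hp.le (hosc r hr))
  · rintro ⟨g, hg, hlt⟩
    have h1 := hmain g hg
    have h2 : 0 ≤ supNorm K (fun x => ω ‖x‖ - g x) := by
      refine Real.sSup_nonneg ?_
      rintro d ⟨x, -, rfl⟩
      exact abs_nonneg _
    unfold domNorm at hlt
    linarith
end

section
/- Let ω be an oscillation function, concave and pointwise differentiable on (0, δ) for some δ > 0, satisfying (i) ∫₀^R ω(r)/r dr < ∞ (Dini condition), (ii) lim_{r→0} ω(r)/r = +∞, and (iii) lim_{r→0} ω(r)/(r ω'(r)) = C₁ where 1 < C₁ ≤ +∞. Define B(r) = ( r ∫_r^R ω(s)/s² ds ) / ( ∫₀^r ω(s)/s ds ). Then lim_{r→0} B(r) = 1/(C₁ − 1) (interpreted as 0 when C₁ = +∞). In particular B(r) is bounded in a neighborhood of the origin. -/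
open Set MeasureTheory Filter Topology

open scoped ENNReal

lemma IsOsc.continuousOn_Ioo {ω : ℝ → ℝ} {R : ℝ} (hω : IsOsc ω R) :
    ContinuousOn ω (Ioo 0 R) :=
  hω.cont.mono Ioo_subset_Icc_self

lemma intervalIntegrable_div_self_of_integrableOn {ω : ℝ → ℝ} {R r : ℝ}
    (hdini : IntegrableOn (fun s => ω s / s) (Ioc 0 R)) (hr : 0 ≤ r) (hrR : r ≤ R) :
    IntervalIntegrable (fun s => ω s / s) volume 0 r := by
  rw [intervalIntegrable_iff_integrableOn_Ioc_of_le hr]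
  exact hdini.mono_set (Ioc_subset_Ioc_right hrR)

lemma IsOsc.hasDerivAt_integral_div {ω : ℝ → ℝ} {R r : ℝ} (hω : IsOsc ω R)
    (hdini : IntegrableOn (fun s => ω s / s) (Ioc 0 R)) (hr : r ∈ Ioo 0 R) :
    HasDerivAt (fun x => ∫ s in (0:ℝ)..x, ω s / s) (ω r / r) r := by
  have hc : ContinuousOn (fun s => ω s / s) (Ioo 0 R) :=
    hω.continuousOn_Ioo.div continuousOn_id fun s hs => hs.1.ne'
  exact intervalIntegral.integral_hasDerivAt_right
    (intervalIntegrable_div_self_of_integrableOn hdini hr.1.le hr.2.le)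
    (hc.stronglyMeasurableAtFilter isOpen_Ioo r hr) (hc.continuousAt (isOpen_Ioo.mem_nhds hr))

lemma IsOsc.hasDerivAt_integral_div_sq {ω : ℝ → ℝ} {R r : ℝ} (hω : IsOsc ω R)
    (hr : r ∈ Ioo 0 R) :
    HasDerivAt (fun x => ∫ s in x..R, ω s / s ^ 2) (-(ω r / r ^ 2)) r := by
  have hc : ContinuousOn (fun s => ω s / s ^ 2) (Ioc 0 R) :=
    (hω.cont.mono Ioc_subset_Icc_self).div (continuousOn_id.pow 2)
      fun s hs => (pow_pos hs.1 2).ne'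
  have hc' := hc.mono Ioo_subset_Ioc_self
  refine intervalIntegral.integral_hasDerivAt_left ?_
    (hc'.stronglyMeasurableAtFilter isOpen_Ioo r hr) (hc'.continuousAt (isOpen_Ioo.mem_nhds hr))
  apply ContinuousOn.intervalIntegrable
  rw [uIcc_of_le hr.2.le]
  exact hc.mono fun s hs => ⟨hr.1.trans_le hs.1, hs.2⟩

lemma IsOsc.hasDerivAt_integral_sub {ω : ℝ → ℝ} {R r : ℝ} (hω : IsOsc ω R)
    (hdini : IntegrableOn (fun s => ω s / s) (Ioc 0 R)) (hr : r ∈ Ioo 0 R) (c : ℝ) :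
    HasDerivAt (fun x => (∫ s in (0:ℝ)..x, ω s / s) / x - (c - 1) * ∫ s in x..R, ω s / s ^ 2)
      ((c * ω r - ∫ s in (0:ℝ)..r, ω s / s) / r ^ 2) r := by
  have hr0 := hr.1.ne'
  refine (((hω.hasDerivAt_integral_div hdini hr).fun_div (hasDerivAt_id' r) hr0).fun_sub
    ((hω.hasDerivAt_integral_div_sq hr).const_mul (c - 1))).congr_deriv ?_
  field_simp
  ring

lemma IsOsc.continuousOn_integral_sub {ω : ℝ → ℝ} {R η : ℝ} (hω : IsOsc ω R)
    (hdini : IntegrableOn (fun s => ω s / s) (Ioc 0 R)) (hη : 0 ≤ η) (hηR : η ≤ R) (c : ℝ) :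
    ContinuousOn (fun x => (∫ s in (0:ℝ)..x, ω s / s) - c * ω x) (Icc 0 η) := by
  refine ContinuousOn.sub ?_ ((hω.cont.mono (Icc_subset_Icc_right hηR)).const_mul c)
  have := intervalIntegral.continuousOn_primitive_interval (a := 0) (b := η) (μ := volume)
    (f := fun s => ω s / s) (by
      rw [uIcc_of_le hη, integrableOn_Icc_iff_integrableOn_Ioc]
      exact hdini.mono_set (Ioc_subset_Ioc_right hηR))
  rwa [uIcc_of_le hη] at this

lemma exists_Ioo_of_eventually_nhdsGT {p : ℝ → Prop} {δ : ℝ} (hδ : 0 < δ)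
    (h : ∀ᶠ r in 𝓝[>] 0, p r) : ∃ η, 0 < η ∧ η < δ ∧ ∀ r ∈ Ioo 0 η, p r := by
  obtain ⟨ε, hε, hp⟩ := mem_nhdsGT_iff_exists_Ioo_subset.1 h
  have hε : 0 < ε := hε
  refine ⟨min ε (δ / 2), by positivity, (min_le_right _ _).trans_lt (by linarith), fun r hr => ?_⟩
  exact hp ⟨hr.1, hr.2.trans_le (min_le_left _ _)⟩

lemma IsOsc.eventually_le_integral {ω : ℝ → ℝ} {R δ c : ℝ} (hω : IsOsc ω R) (hδ : 0 < δ)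
    (hδR : δ ≤ R) (hdiff : ∀ r ∈ Ioo (0:ℝ) δ, DifferentiableAt ℝ ω r)
    (hdini : IntegrableOn (fun s => ω s / s) (Ioc 0 R))
    (h : ∀ᶠ r in 𝓝[>] 0, c * (r * deriv ω r) ≤ ω r) :
    ∀ᶠ r in 𝓝[>] 0, c * ω r ≤ ∫ s in (0:ℝ)..r, ω s / s := by
  obtain ⟨η, hη, hηδ, hp⟩ := exists_Ioo_of_eventually_nhdsGT hδ h
  have hmono : MonotoneOn (fun x => (∫ s in (0:ℝ)..x, ω s / s) - c * ω x) (Icc 0 η) := by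
    refine monotoneOn_of_hasDerivWithinAt_nonneg (f' := fun x => ω x / x - c * deriv ω x)
      (convex_Icc 0 η) (hω.continuousOn_integral_sub hdini hη.le (by linarith) c) ?_ ?_ <;>
      rw [interior_Icc] <;> intro x hx
    · exact ((hω.hasDerivAt_integral_div hdini ⟨hx.1, by linarith [hx.2]⟩).sub
        ((hdiff x ⟨hx.1, hx.2.trans hηδ⟩).hasDerivAt.const_mul c)).hasDerivWithinAt
    · rw [sub_nonneg, le_div_iff₀ hx.1]
      linarith [hp x hx]
  filter_upwards [Ioo_mem_nhdsGT hη] with r hr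
  have := hmono ⟨le_rfl, hη.le⟩ ⟨hr.1.le, hr.2.le⟩ hr.1.le
  simp only [intervalIntegral.integral_same, hω.zero] at this
  linarith

lemma IsOsc.eventually_integral_le {ω : ℝ → ℝ} {R δ c : ℝ} (hω : IsOsc ω R) (hδ : 0 < δ)
    (hδR : δ ≤ R) (hdiff : ∀ r ∈ Ioo (0:ℝ) δ, DifferentiableAt ℝ ω r)
    (hdini : IntegrableOn (fun s => ω s / s) (Ioc 0 R))
    (h : ∀ᶠ r in 𝓝[>] 0, ω r ≤ c * (r * deriv ω r)) :
    ∀ᶠ r in 𝓝[>] 0, ∫ s in (0:ℝ)..r, ω s / s ≤ c * ω r := by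
  obtain ⟨η, hη, hηδ, hp⟩ := exists_Ioo_of_eventually_nhdsGT hδ h
  have hanti : AntitoneOn (fun x => (∫ s in (0:ℝ)..x, ω s / s) - c * ω x) (Icc 0 η) := by
    refine antitoneOn_of_hasDerivWithinAt_nonpos (f' := fun x => ω x / x - c * deriv ω x)
      (convex_Icc 0 η) (hω.continuousOn_integral_sub hdini hη.le (by linarith) c) ?_ ?_ <;>
      rw [interior_Icc] <;> intro x hx
    · exact ((hω.hasDerivAt_integral_div hdini ⟨hx.1, by linarith [hx.2]⟩).sub
        ((hdiff x ⟨hx.1, hx.2.trans hηδ⟩).hasDerivAt.const_mul c)).hasDerivWithinAt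
    · rw [sub_nonpos, div_le_iff₀ hx.1]
      linarith [hp x hx]
  filter_upwards [Ioo_mem_nhdsGT hη] with r hr
  have := hanti ⟨le_rfl, hη.le⟩ ⟨hr.1.le, hr.2.le⟩ hr.1.le
  simp only [intervalIntegral.integral_same, hω.zero] at this
  linarith

lemma mul_div_eq_div_div_self {r N F : ℝ} : r * N / F = N / (F / r) := by
  rw [div_div_eq_mul_div, mul_comm]

lemma IsOsc.eventually_quotient_lt {ω : ℝ → ℝ} {R c u : ℝ} (hω : IsOsc ω R) (hR : 0 < R)
    (hdini : IntegrableOn (fun s => ω s / s) (Ioc 0 R))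
    (hG : Tendsto (fun r => (∫ s in (0:ℝ)..r, ω s / s) / r) (𝓝[>] 0) atTop)
    (hc : 1 < c) (h : ∀ᶠ r in 𝓝[>] 0, c * ω r ≤ ∫ s in (0:ℝ)..r, ω s / s)
    (hu : 1 / (c - 1) < u) :
    ∀ᶠ r in 𝓝[>] 0, (r * ∫ s in r..R, ω s / s ^ 2) / (∫ s in (0:ℝ)..r, ω s / s) < u := by
  obtain ⟨η, hη, hηR, hp⟩ := exists_Ioo_of_eventually_nhdsGT hR h
  have hder := fun x (hx : x ∈ Ioo 0 η) =>
    hω.hasDerivAt_integral_sub hdini (r := x) ⟨hx.1, hx.2.trans hηR⟩ c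
  have hanti := antitoneOn_of_hasDerivWithinAt_nonpos (convex_Ioo 0 η)
    (fun x hx => (hder x hx).continuousAt.continuousWithinAt)
    (fun x hx => (hder x (interior_subset hx)).hasDerivWithinAt)
    (fun x hx => div_nonpos_of_nonpos_of_nonneg
      (by linarith [hp x (interior_subset hx)]) (sq_nonneg x))
  obtain ⟨K, hK⟩ : ∃ K, ∀ r ∈ Ioo 0 (η / 2), K ≤
      (∫ s in (0:ℝ)..r, ω s / s) / r - (c - 1) * ∫ s in r..R, ω s / s ^ 2 :=
    ⟨_, fun r hr => hanti ⟨hr.1, by linarith [hr.2]⟩ ⟨by linarith, by linarith⟩ hr.2.le⟩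
  have hc0 : 0 < c - 1 := by linarith
  rw [div_lt_iff₀ hc0] at hu
  have hu' : 0 < u * (c - 1) - 1 := by linarith
  filter_upwards [Ioo_mem_nhdsGT (half_pos hη), hG.eventually_gt_atTop 0,
    hG.eventually_gt_atTop (-K / (u * (c - 1) - 1))] with r hr hpos hlarge
  rw [mul_div_eq_div_div_self, div_lt_iff₀ hpos]
  rw [div_lt_iff₀ hu'] at hlarge
  have := hK r hr
  refine lt_of_mul_lt_mul_left ?_ hc0.le
  linarith

lemma IsOsc.eventually_lt_quotient {ω : ℝ → ℝ} {R c l : ℝ} (hω : IsOsc ω R) (hR : 0 < R)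
    (hdini : IntegrableOn (fun s => ω s / s) (Ioc 0 R))
    (hG : Tendsto (fun r => (∫ s in (0:ℝ)..r, ω s / s) / r) (𝓝[>] 0) atTop)
    (hc : 1 < c) (h : ∀ᶠ r in 𝓝[>] 0, ∫ s in (0:ℝ)..r, ω s / s ≤ c * ω r)
    (hl : l < 1 / (c - 1)) :
    ∀ᶠ r in 𝓝[>] 0, l < (r * ∫ s in r..R, ω s / s ^ 2) / (∫ s in (0:ℝ)..r, ω s / s) := by
  obtain ⟨η, hη, hηR, hp⟩ := exists_Ioo_of_eventually_nhdsGT hR h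
  have hder := fun x (hx : x ∈ Ioo 0 η) =>
    hω.hasDerivAt_integral_sub hdini (r := x) ⟨hx.1, hx.2.trans hηR⟩ c
  have hmono := monotoneOn_of_hasDerivWithinAt_nonneg (convex_Ioo 0 η)
    (fun x hx => (hder x hx).continuousAt.continuousWithinAt)
    (fun x hx => (hder x (interior_subset hx)).hasDerivWithinAt)
    (fun x hx => div_nonneg (by linarith [hp x (interior_subset hx)]) (sq_nonneg x))
  obtain ⟨K, hK⟩ : ∃ K, ∀ r ∈ Ioo 0 (η / 2),
      (∫ s in (0:ℝ)..r, ω s / s) / r - (c - 1) * ∫ s in r..R, ω s / s ^ 2 ≤ K :=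
    ⟨_, fun r hr => hmono ⟨hr.1, by linarith [hr.2]⟩ ⟨by linarith, by linarith⟩ hr.2.le⟩
  have hc0 : 0 < c - 1 := by linarith
  rw [lt_div_iff₀ hc0] at hl
  have hl' : 0 < 1 - l * (c - 1) := by linarith
  filter_upwards [Ioo_mem_nhdsGT (half_pos hη), hG.eventually_gt_atTop 0,
    hG.eventually_gt_atTop (K / (1 - l * (c - 1)))] with r hr hpos hlarge
  rw [mul_div_eq_div_div_self, lt_div_iff₀ hpos]
  rw [div_lt_iff₀ hl'] at hlarge
  have := hK r hr
  refine lt_of_mul_lt_mul_left ?_ hc0.le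
  linarith

lemma tendsto_one_div_sub_one {c : ℝ} (hc : 1 < c) :
    Tendsto (fun x : ℝ => 1 / (x - 1)) (𝓝 c) (𝓝 (1 / (c - 1))) :=
  tendsto_const_nhds.div (tendsto_id.sub_const 1) (by linarith)

/-- Behaviour of `B(r) = (r ∫_r^R ω(s)/s² ds)/(∫_0^r ω(s)/s ds)` as `r → 0⁺`:
if `ω(r)/(r ω'(r)) → C₁ ∈ (1, ∞]`, then `B(r) → 1/(C₁ - 1)` (which is `0` when `C₁ = ∞`);
in particular `B` is bounded near the origin. -/
theorem B_tendsto (R δ : ℝ) (hR : 0 < R) (hδ : 0 < δ) (hδR : δ ≤ R)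
    (ω : ℝ → ℝ) (hω : IsOsc ω R)
    (hconc : ConcaveOn ℝ (Set.Icc 0 δ) ω)
    (hdiff : ∀ r ∈ Set.Ioo (0:ℝ) δ, DifferentiableAt ℝ ω r)
    (hdini : IntegrableOn (fun s => ω s / s) (Set.Ioc 0 R))
    (hinf : Filter.Tendsto (fun r => ω r / r) (nhdsWithin 0 (Set.Ioi 0)) Filter.atTop)
    (C₁ : ℝ≥0∞) (hC₁ : 1 < C₁)
    (hlim : Filter.Tendsto (fun r => ENNReal.ofReal (ω r / (r * deriv ω r)))
      (nhdsWithin 0 (Set.Ioi 0)) (nhds C₁)) :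
    Filter.Tendsto
      (fun r => ENNReal.ofReal
        ((r * ∫ s in r..R, ω s / s ^ 2) / ∫ s in (0:ℝ)..r, ω s / s))
      (nhdsWithin 0 (Set.Ioi 0)) (nhds (1 / (C₁ - 1))) ∧
    ∃ C₂ δ₀ : ℝ, 0 < δ₀ ∧ ∀ r ∈ Set.Ioo (0:ℝ) δ₀,
      (r * ∫ s in r..R, ω s / s ^ 2) / (∫ s in (0:ℝ)..r, ω s / s) ≤ C₂ := by
  have hωpos : ∀ᶠ r in 𝓝[>] (0:ℝ), 0 < r ∧ 0 < ω r := by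
    filter_upwards [Ioo_mem_nhdsGT hR] with r hr
    exact ⟨hr.1, hω.pos r hr.1 hr.2.le⟩
  have hlow : ∀ c : ℝ, 0 < c → ENNReal.ofReal c < C₁ →
      ∀ᶠ r in 𝓝[>] (0:ℝ), 0 < r * deriv ω r ∧ c * (r * deriv ω r) ≤ ω r := by
    intro c hc hcC
    filter_upwards [hlim.eventually_const_lt hcC, hωpos] with r hr ⟨_, hr1⟩
    have hr2 : c < ω r / (r * deriv ω r) := (ENNReal.ofReal_lt_ofReal_iff').1 hr |>.1
    have hr3 : 0 < r * deriv ω r := (div_pos_iff_of_pos_left hr1).1 (hc.trans hr2)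
    exact ⟨hr3, ((lt_div_iff₀ hr3).1 hr2).le⟩
  have hF : ∀ c : ℝ, 0 < c → ENNReal.ofReal c < C₁ →
      ∀ᶠ r in 𝓝[>] (0:ℝ), c * ω r ≤ ∫ s in (0:ℝ)..r, ω s / s := fun c hc hcC =>
    hω.eventually_le_integral hδ hδR hdiff hdini ((hlow c hc hcC).mono fun _ h => h.2)
  have hG : Tendsto (fun r => (∫ s in (0:ℝ)..r, ω s / s) / r) (𝓝[>] 0) atTop := by
    refine tendsto_atTop_mono' _ ?_ hinf
    filter_upwards [hF 1 one_pos (by simpa using hC₁), hωpos] with r hr ⟨hr0, _⟩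
    rw [one_mul] at hr
    gcongr
  have hupper : ∀ c : ℝ, 1 < c → ENNReal.ofReal c < C₁ → ∀ u, 1 / (c - 1) < u →
      ∀ᶠ r in 𝓝[>] (0:ℝ),
        (r * ∫ s in r..R, ω s / s ^ 2) / (∫ s in (0:ℝ)..r, ω s / s) < u := fun c hc hcC u hu =>
    hω.eventually_quotient_lt hR hdini hG hc (hF c (by linarith) hcC) hu
  constructor
  · induction C₁ using ENNReal.recTopCoe with
    | top =>
      have : (1 : ℝ≥0∞) / (⊤ - 1) = ENNReal.ofReal 0 := by simp
      rw [this]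
      refine ENNReal.tendsto_ofReal (tendsto_order.2 ⟨fun l hl => ?_, fun u hu => ?_⟩)
      · filter_upwards [Ioo_mem_nhdsGT hR] with r hr
        refine hl.trans_le (div_nonneg (mul_nonneg hr.1.le ?_) ?_)
        · refine intervalIntegral.integral_nonneg hr.2.le fun s hs => ?_
          have := hω.pos s (hr.1.trans_le hs.1) hs.2
          positivity
        · refine intervalIntegral.integral_nonneg hr.1.le fun s hs => ?_
          have : 0 ≤ ω s := by
            have := hω.mono ⟨le_rfl, hR.le⟩ ⟨hs.1, hs.2.trans hr.2.le⟩ hs.1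
            rwa [hω.zero] at this
          exact div_nonneg this hs.1
      · refine hupper (1 + 2 / u) (by simpa using hu) ENNReal.ofReal_lt_top u ?_
        rw [add_sub_cancel_left, one_div_div]
        linarith
    | coe c =>
      have hc : (1 : ℝ) < c := by exact_mod_cast hC₁
      have : (1 : ℝ≥0∞) / (c - 1) = ENNReal.ofReal (1 / ((c : ℝ) - 1)) := by
        rw [ENNReal.ofReal_div_of_pos (by linarith), ENNReal.ofReal_sub _ zero_le_one]
        simp
      rw [this]
      refine ENNReal.tendsto_ofReal (tendsto_order.2 ⟨fun l hl => ?_, fun u hu => ?_⟩)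
      · obtain ⟨d, hd, hcd⟩ := ((((tendsto_one_div_sub_one hc).mono_left
          (nhdsWithin_le_nhds (s := Ioi (c : ℝ)))).eventually_const_lt hl).and
          self_mem_nhdsWithin).exists
        have hcd : (c : ℝ) < d := hcd
        refine hω.eventually_lt_quotient hR hdini hG (hc.trans hcd) ?_ hd
        refine hω.eventually_integral_le hδ hδR hdiff hdini ?_
        have hcd' : (c : ℝ≥0∞) < ENNReal.ofReal d := by
          rw [← ENNReal.ofReal_coe_nnreal]
          exact (ENNReal.ofReal_lt_ofReal_iff (by linarith)).2 hcd
        filter_upwards [hlim.eventually_lt_const hcd',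
          hlow 1 one_pos (by simpa using hC₁)] with r hr ⟨hr0, _⟩
        exact ((div_lt_iff₀ hr0).1 (ENNReal.ofReal_lt_ofReal_iff'.1 hr).1).le
      · obtain ⟨d, hd, h1d, hdc⟩ := ((((tendsto_one_div_sub_one hc).mono_left
          (nhdsWithin_le_nhds (s := Iio (c : ℝ)))).eventually_lt_const hu).and
          (Ioo_mem_nhdsLT hc)).exists
        refine hupper d h1d ?_ u hd
        rw [← ENNReal.ofReal_coe_nnreal]
        exact (ENNReal.ofReal_lt_ofReal_iff (by linarith)).2 hdc
  · obtain ⟨c, hc, h1c, hcC⟩ : ∃ c : ℝ, 0 ≤ c ∧ 1 < c ∧ ENNReal.ofReal c < C₁ := by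
      obtain ⟨c, h1c, hcC⟩ := ENNReal.lt_iff_exists_nnreal_btwn.1 hC₁
      exact ⟨c, c.2, by exact_mod_cast h1c, by simpa using hcC⟩
    obtain ⟨η, hη, -, hp⟩ := exists_Ioo_of_eventually_nhdsGT hδ
      (hupper c h1c hcC (1 / (c - 1) + 1) (by linarith))
    exact ⟨1 / (c - 1) + 1, η, hη, fun r hr => (hp r hr).le⟩
end

section
/- Let ω be an oscillation function, pointwise differentiable on (0, δ), with ∫₀^R ω(r)/r dr < ∞, and suppose lim_{r→0} ω(r)/(r ω'(r)) = C₁ with 1 < C₁ < ∞. Define ĥ(r) = ∫₀^r ω(s)/s ds. Then lim_{r→0} ĥ(r)/ω(r) = C₁. In particular there is k₁ > 0 with ω(r) ≤ k₁ ĥ(r) near the origin, so D_ω(Ω̄) = D_{ĥ}(Ω̄) with equivalent norms. -/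
open Set Metric MeasureTheory Filter Topology

/-- The oscillation of a function is nonnegative. -/
lemma oscf_nonneg {n : ℕ} (K : Set (EuclideanSpace ℝ (Fin n)))
    (f : EuclideanSpace ℝ (Fin n) → ℝ) (r : ℝ) : 0 ≤ oscf K f r := by
  refine Real.sSup_nonneg ?_
  rintro d ⟨x, -, y, -, -, -, rfl⟩
  exact abs_nonneg _

/-- The sup norm is nonnegative. -/
lemma supNorm_nonneg {n : ℕ} (K : Set (EuclideanSpace ℝ (Fin n)))
    (f : EuclideanSpace ℝ (Fin n) → ℝ) : 0 ≤ supNorm K f := by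
  refine Real.sSup_nonneg ?_
  rintro d ⟨x, -, rfl⟩
  exact abs_nonneg _

section Comparison

variable {n : ℕ} {K : Set (EuclideanSpace ℝ (Fin n))} {f : EuclideanSpace ℝ (Fin n) → ℝ}
  {ω₁ ω₂ : ℝ → ℝ} {R M : ℝ}

/-- If `ω₁ ≤ M ω₂`, every element of `semiSet K ω₂ R f` is at most `M` times the supremum of
`semiSet K ω₁ R f`. -/
lemma le_mul_domSemi_of_mem_semiSet (hM : 0 ≤ M) (h₁ : ∀ r ∈ Ioo 0 R, 0 < ω₁ r)
    (h₂ : ∀ r ∈ Ioo 0 R, 0 < ω₂ r) (hle : ∀ r ∈ Ioo 0 R, ω₁ r ≤ M * ω₂ r)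
    (hb : BddAbove (semiSet K ω₁ R f)) {c : ℝ} (hc : c ∈ semiSet K ω₂ R f) :
    c ≤ M * domSemi K ω₁ R f := by
  obtain ⟨r, hr, rfl⟩ := hc
  have hsup : oscf K f r / ω₁ r ≤ domSemi K ω₁ R f := le_csSup hb ⟨r, hr, rfl⟩
  refine le_trans ?_ (mul_le_mul_of_nonneg_left hsup hM)
  rw [← mul_div_assoc, div_le_div_iff₀ (h₂ r hr) (h₁ r hr)]
  nlinarith [mul_le_mul_of_nonneg_left (hle r hr) (oscf_nonneg K f r)]

lemma MemD.of_le_mul (hM : 0 ≤ M) (h₁ : ∀ r ∈ Ioo 0 R, 0 < ω₁ r)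
    (h₂ : ∀ r ∈ Ioo 0 R, 0 < ω₂ r) (hle : ∀ r ∈ Ioo 0 R, ω₁ r ≤ M * ω₂ r)
    (hf : MemD K ω₁ R f) : MemD K ω₂ R f :=
  ⟨hf.1, _, fun _ hc => le_mul_domSemi_of_mem_semiSet hM h₁ h₂ hle hf.2 hc⟩

lemma MemD.domNorm_le (hR : 0 < R) (hM : 1 ≤ M) (h₁ : ∀ r ∈ Ioo 0 R, 0 < ω₁ r)
    (h₂ : ∀ r ∈ Ioo 0 R, 0 < ω₂ r) (hle : ∀ r ∈ Ioo 0 R, ω₁ r ≤ M * ω₂ r)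
    (hf : MemD K ω₁ R f) : domNorm K ω₂ R f ≤ M * domNorm K ω₁ R f := by
  have hsemi : domSemi K ω₂ R f ≤ M * domSemi K ω₁ R f :=
    csSup_le ⟨_, R / 2, ⟨by linarith, by linarith⟩, rfl⟩
      fun _ hc => le_mul_domSemi_of_mem_semiSet (by linarith) h₁ h₂ hle hf.2 hc
  unfold domNorm
  nlinarith [supNorm_nonneg K f]

end Comparison

/-- Two positive monotone functions on `(0, R]` whose quotient converges at `0` are comparable. -/
lemma exists_le_mul_of_tendsto_div {f g : ℝ → ℝ} {R C : ℝ}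
    (hf : MonotoneOn f (Ioc 0 R)) (hg : MonotoneOn g (Ioc 0 R))
    (hgpos : ∀ r ∈ Ioc 0 R, 0 < g r) (h : Tendsto (fun r => f r / g r) (𝓝[>] 0) (𝓝 C)) :
    ∃ M, ∀ r ∈ Ioo 0 R, f r ≤ M * g r := by
  rcases le_or_gt R 0 with hR | hR
  · exact ⟨0, fun r hr => absurd (hr.1.trans hr.2) hR.not_gt⟩
  obtain ⟨u, hu, hus⟩ := mem_nhdsGT_iff_exists_Ioo_subset.1
    (h.eventually (gt_mem_nhds (lt_add_one C)))
  have hu0 : 0 < u := hu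
  set d := min u R
  have hdmem : d ∈ Ioc 0 R := ⟨lt_min hu0 hR, min_le_right _ _⟩
  refine ⟨max (C + 1) (|f R| / g d), fun r hr => ?_⟩
  have hrmem : r ∈ Ioc 0 R := ⟨hr.1, hr.2.le⟩
  rcases lt_or_ge r d with hrd | hrd
  · have hlt : f r / g r < C + 1 := hus ⟨hr.1, hrd.trans_le (min_le_left _ _)⟩
    exact (div_le_iff₀ (hgpos r hrmem)).1 (hlt.le.trans (le_max_left _ _))
  · calc f r ≤ f R := hf hrmem ⟨hR, le_rfl⟩ hr.2.le
      _ ≤ |f R| := le_abs_self _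
      _ = |f R| / g d * g d := (div_mul_cancel₀ _ (hgpos d hdmem).ne').symm
      _ ≤ |f R| / g d * g r := mul_le_mul_of_nonneg_left (hg hdmem hrmem hrd)
          (div_nonneg (abs_nonneg _) (hgpos d hdmem).le)
      _ ≤ max (C + 1) (|f R| / g d) * g r :=
          mul_le_mul_of_nonneg_right (le_max_right _ _) (hgpos r hrmem).le

namespace IsOsc

variable {ω : ℝ → ℝ} {R : ℝ}

lemma intervalIntegrable_div (hdini : IntegrableOn (fun s => ω s / s) (Ioc 0 R)) {a b : ℝ}
    (ha : 0 ≤ a) (hab : a ≤ b) (hb : b ≤ R) :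
    IntervalIntegrable (fun s => ω s / s) volume a b :=
  (intervalIntegrable_iff_integrableOn_Ioc_of_le hab).2 (hdini.mono_set (Ioc_subset_Ioc ha hb))

lemma monotoneOn_integral_div (hω : IsOsc ω R)
    (hdini : IntegrableOn (fun s => ω s / s) (Ioc 0 R)) :
    MonotoneOn (fun r => ∫ s in (0:ℝ)..r, ω s / s) (Ioc 0 R) := by
  intro a ha b hb hab
  have hadd := intervalIntegral.integral_add_adjacent_intervals
    (intervalIntegrable_div hdini le_rfl ha.1.le ha.2)
    (intervalIntegrable_div hdini ha.1.le hab hb.2)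
  have hnn : 0 ≤ ∫ s in a..b, ω s / s := intervalIntegral.integral_nonneg hab fun s hs =>
    div_nonneg (hω.pos s (ha.1.trans_le hs.1) (hs.2.trans hb.2)).le (ha.1.le.trans hs.1)
  show (∫ s in (0:ℝ)..a, ω s / s) ≤ ∫ s in (0:ℝ)..b, ω s / s
  linarith

lemma integral_div_pos (hω : IsOsc ω R) (hdini : IntegrableOn (fun s => ω s / s) (Ioc 0 R))
    {r : ℝ} (hr : r ∈ Ioc 0 R) : 0 < ∫ s in (0:ℝ)..r, ω s / s :=
  intervalIntegral.intervalIntegral_pos_of_pos_on (intervalIntegrable_div hdini le_rfl hr.1.le hr.2)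
    (fun s hs => div_pos (hω.pos s hs.1 (hs.2.le.trans hr.2)) hs.1) hr.1

lemma hasDerivAt_integral_div_s11 (hω : IsOsc ω R)
    (hdini : IntegrableOn (fun s => ω s / s) (Ioc 0 R)) {r : ℝ} (hr : r ∈ Ioo 0 R) :
    HasDerivAt (fun r => ∫ s in (0:ℝ)..r, ω s / s) (ω r / r) r := by
  have hcont : ContinuousOn (fun s => ω s / s) (Ioo 0 R) :=
    (hω.cont.mono Ioo_subset_Icc_self).div continuousOn_id fun s hs => hs.1.ne'
  exact intervalIntegral.integral_hasDerivAt_right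
    (intervalIntegrable_div hdini le_rfl hr.1.le hr.2.le)
    (hcont.stronglyMeasurableAtFilter isOpen_Ioo r hr) (hcont.continuousAt (isOpen_Ioo.mem_nhds hr))

lemma tendsto_zero (hR : 0 < R) (hω : IsOsc ω R) : Tendsto ω (𝓝[>] 0) (𝓝 0) := by
  have h := ((hω.cont 0 (left_mem_Icc.2 hR.le)).mono Ioo_subset_Icc_self).tendsto
  rwa [hω.zero, nhdsWithin_Ioo_eq_nhdsGT hR] at h

lemma tendsto_integral_div_zero (hR : 0 < R)
    (hdini : IntegrableOn (fun s => ω s / s) (Ioc 0 R)) :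
    Tendsto (fun r => ∫ s in (0:ℝ)..r, ω s / s) (𝓝[>] 0) (𝓝 0) := by
  have hc := intervalIntegral.continuousOn_primitive_interval'
    (intervalIntegrable_div hdini le_rfl hR.le le_rfl) left_mem_uIcc
  rw [uIcc_of_le hR.le] at hc
  have h := ((hc 0 (left_mem_Icc.2 hR.le)).mono Ioo_subset_Icc_self).tendsto
  rwa [intervalIntegral.integral_same, nhdsWithin_Ioo_eq_nhdsGT hR] at h

/-- L'Hôpital's rule for `ĥ(r) = ∫₀^r ω(s)/s ds` against `ω`. -/
lemma tendsto_integral_div_div {δ C : ℝ} (hR : 0 < R) (hδ : 0 < δ) (hω : IsOsc ω R)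
    (hdiff : ∀ r ∈ Ioo 0 δ, DifferentiableAt ℝ ω r)
    (hdini : IntegrableOn (fun s => ω s / s) (Ioc 0 R)) (hC : C ≠ 0)
    (hlim : Tendsto (fun r => ω r / (r * deriv ω r)) (𝓝[>] 0) (𝓝 C)) :
    Tendsto (fun r => (∫ s in (0:ℝ)..r, ω s / s) / ω r) (𝓝[>] 0) (𝓝 C) := by
  refine HasDerivAt.lhopital_zero_nhdsGT (f' := fun r => ω r / r) (g' := deriv ω) ?_ ?_ ?_
    (tendsto_integral_div_zero hR hdini) (hω.tendsto_zero hR) ?_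
  · filter_upwards [Ioo_mem_nhdsGT hR] with r hr using hω.hasDerivAt_integral_div_s11 hdini hr
  · filter_upwards [Ioo_mem_nhdsGT hδ] with r hr using (hdiff r hr).hasDerivAt
  · filter_upwards [hlim.eventually_ne hC] with r hr h0
    simp [h0] at hr
  · simpa only [div_div] using hlim

end IsOsc

/-- If `ω(r)/(r ω'(r)) → C₁ ∈ (1,∞)` as `r → 0⁺`, then `ĥ(r)/ω(r) → C₁` where
`ĥ(r) = ∫₀^r ω(s)/s ds`; in particular `ω ≤ k₁ ĥ` near the origin and
`D_ω(Ω̄) = D_{ĥ}(Ω̄)` with equivalent norms. -/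
theorem hhat_div_osc_tendsto (R δ : ℝ) (hR : 0 < R) (hδ : 0 < δ) (hδR : δ ≤ R)
    (ω : ℝ → ℝ) (hω : IsOsc ω R)
    (hdiff : ∀ r ∈ Set.Ioo (0:ℝ) δ, DifferentiableAt ℝ ω r)
    (hdini : IntegrableOn (fun s => ω s / s) (Set.Ioc 0 R))
    (C₁ : ℝ) (hC₁ : 1 < C₁)
    (hlim : Filter.Tendsto (fun r => ω r / (r * deriv ω r))
      (nhdsWithin 0 (Set.Ioi 0)) (nhds C₁)) :
    Filter.Tendsto (fun r => (∫ s in (0:ℝ)..r, ω s / s) / ω r)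
      (nhdsWithin 0 (Set.Ioi 0)) (nhds C₁) ∧
    (∃ k₁ δ' : ℝ, 0 < k₁ ∧ 0 < δ' ∧
      ∀ r ∈ Set.Ioo (0:ℝ) δ', ω r ≤ k₁ * ∫ s in (0:ℝ)..r, ω s / s) ∧
    ∀ (n : ℕ) (K : Set (EuclideanSpace ℝ (Fin n))), IsCompact K →
      (∀ f, MemD K ω R f ↔ MemD K (fun r => ∫ s in (0:ℝ)..r, ω s / s) R f) ∧
      ∃ c : ℝ, 0 < c ∧ ∀ f, MemD K ω R f →
        domNorm K ω R f ≤ c * domNorm K (fun r => ∫ s in (0:ℝ)..r, ω s / s) R f ∧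
        domNorm K (fun r => ∫ s in (0:ℝ)..r, ω s / s) R f ≤ c * domNorm K ω R f := by
  have hpos : ∀ r ∈ Ioc 0 R, 0 < ω r := fun r hr => hω.pos r hr.1 hr.2
  have hhpos : ∀ r ∈ Ioc 0 R, 0 < ∫ s in (0:ℝ)..r, ω s / s :=
    fun r hr => hω.integral_div_pos hdini hr
  have hmono : MonotoneOn ω (Ioc 0 R) := hω.mono.mono Ioc_subset_Icc_self
  have hhmono := hω.monotoneOn_integral_div hdini
  have htend := hω.tendsto_integral_div_div hR hδ hdiff hdini (by linarith) hlim
  refine ⟨htend, ?_, fun n K _ => ?_⟩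
  · obtain ⟨u, hu, hus⟩ := mem_nhdsGT_iff_exists_Ioo_subset.1
      (htend.eventually (lt_mem_nhds hC₁))
    have hu0 : 0 < u := hu
    refine ⟨1, min u R, one_pos, lt_min hu0 hR, fun r hr => ?_⟩
    have hlt : 1 < (∫ s in (0:ℝ)..r, ω s / s) / ω r :=
      hus ⟨hr.1, hr.2.trans_le (min_le_left _ _)⟩
    rw [one_mul]
    exact ((one_lt_div (hpos r ⟨hr.1, hr.2.le.trans (min_le_right _ _)⟩)).1 hlt).le
  · have htend' : Tendsto (fun r => ω r / ∫ s in (0:ℝ)..r, ω s / s) (𝓝[>] 0) (𝓝 C₁⁻¹) := by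
      simpa only [inv_div] using htend.inv₀ (by linarith)
    obtain ⟨M₁, hM₁⟩ := exists_le_mul_of_tendsto_div hmono hhmono hhpos htend'
    obtain ⟨M₂, hM₂⟩ := exists_le_mul_of_tendsto_div hhmono hmono hpos htend
    have h₁ : ∀ r ∈ Ioo 0 R, 0 < ω r := fun r hr => hpos r ⟨hr.1, hr.2.le⟩
    have h₂ : ∀ r ∈ Ioo 0 R, 0 < ∫ s in (0:ℝ)..r, ω s / s := fun r hr => hhpos r ⟨hr.1, hr.2.le⟩
    set c := max 1 (max M₁ M₂)
    have hc1 : 1 ≤ c := le_max_left _ _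
    have hc0 : 0 < c := one_pos.trans_le hc1
    have hle₁ : ∀ r ∈ Ioo 0 R, ω r ≤ c * ∫ s in (0:ℝ)..r, ω s / s := fun r hr =>
      (hM₁ r hr).trans (mul_le_mul_of_nonneg_right
        ((le_max_left _ _).trans (le_max_right _ _)) (h₂ r hr).le)
    have hle₂ : ∀ r ∈ Ioo 0 R, (∫ s in (0:ℝ)..r, ω s / s) ≤ c * ω r := fun r hr =>
      (hM₂ r hr).trans (mul_le_mul_of_nonneg_right
        ((le_max_right _ _).trans (le_max_right _ _)) (h₁ r hr).le)
    exact ⟨fun f => ⟨MemD.of_le_mul hc0.le h₁ h₂ hle₁, MemD.of_le_mul hc0.le h₂ h₁ hle₂⟩,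
      c, hc0, fun f hf =>
        ⟨(hf.of_le_mul hc0.le h₁ h₂ hle₁).domNorm_le hR hc1 h₂ h₁ hle₂,
          hf.domNorm_le hR hc1 h₁ h₂ hle₁⟩⟩
end

section
/- (Interior estimate, constant coefficients.) Let n ≥ 3 and let L = Σ a_{ij} ∂ᵢ∂ⱼ be uniformly elliptic with constant symmetric coefficients. Let ω be an oscillation function satisfying ∫₀^R ω(r)/r dr < ∞, lim_{r→0} ω(r)/r = +∞, ω(k₁ r) ≤ c₁ ω(r) near 0 for some k₁ > 1, c₁ > 0, and B(r) = ( r ∫_r^R ω(s)/s² ds )/( ∫₀^r ω(s)/s ds ) ≤ C₂ near 0; set ĥ(r) = ∫₀^r ω(s)/s ds. Then there exist constants C, c > 0, independent of ρ, such that for every ρ ∈ (0, 1/2) and every u twice continuously differentiable on I(2ρ) with Lu ∈ D_ω(I(2ρ)), the second derivatives of u belong to D_{ĥ}(I(ρ)) and [∇²u]_{ĥ; ρ} ≤ C [Lu]_{ω; 2ρ} + (c/ρ³) ‖u‖_{C²(I(2ρ))}, where ‖u‖_{C²(I(2ρ))} = sup over I(2ρ) of |u| + |∇u| + |∇²u|,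 and [∇²u]_{ĥ;ρ} is the maximum over i, j of the D_{ĥ}(I(ρ)) semi-norm of ∂ᵢ∂ⱼu. -/
open Set Metric MeasureTheory Filter Topology

/-- The second partial derivative `∂ᵢ∂ⱼ f` at `x`. -/
noncomputable def pd2 {n : ℕ} (f : EuclideanSpace ℝ (Fin n) → ℝ) (i j : Fin n)
    (x : EuclideanSpace ℝ (Fin n)) : ℝ :=
  fderiv ℝ (fun y => fderiv ℝ f y (EuclideanSpace.single j 1)) x (EuclideanSpace.single i 1)

/-- The `C²` norm on `K`: the supremum of `|u| + |∇u| + |∇²u|`. -/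
noncomputable def c2norm {n : ℕ} (K : Set (EuclideanSpace ℝ (Fin n)))
    (u : EuclideanSpace ℝ (Fin n) → ℝ) : ℝ :=
  sSup {c : ℝ | ∃ x ∈ K, c = |u x| + ‖fderiv ℝ u x‖ + ‖fderiv ℝ (fderiv ℝ u) x‖}

/-- The directional derivative of `f` along the vector `e`. -/
noncomputable def dirD {n : ℕ} (e : EuclideanSpace ℝ (Fin n))
    (f : EuclideanSpace ℝ (Fin n) → ℝ) (x : EuclideanSpace ℝ (Fin n)) : ℝ :=
  fderiv ℝ f x e

section DirectionalDerivative

variable {n : ℕ} {f p q : EuclideanSpace ℝ (Fin n) → ℝ}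

theorem ContDiff.dirD {k m : ℕ∞} (hf : ContDiff ℝ m f) (hkm : k + 1 ≤ m)
    (e : EuclideanSpace ℝ (Fin n)) : ContDiff ℝ k (dirD e f) :=
  (hf.fderiv_right (by exact_mod_cast hkm)).clm_apply contDiff_const

theorem HasCompactSupport.dirD (hf : HasCompactSupport f) (e : EuclideanSpace ℝ (Fin n)) :
    HasCompactSupport (dirD e f) :=
  hf.fderiv_apply ℝ e

theorem dirD_eq_zero_of_lt_norm {ρ : ℝ} (hf : ∀ z, ρ < ‖z‖ → f z = 0)
    (e z : EuclideanSpace ℝ (Fin n)) (hz : ρ < ‖z‖) : dirD e f z = 0 := by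
  have h : f =ᶠ[𝓝 z] fun _ => (0 : ℝ) := by
    filter_upwards [(isOpen_lt continuous_const continuous_norm).mem_nhds hz] with w hw
    exact hf w hw
  simp [dirD, h.fderiv_eq]

theorem hasCompactSupport_of_lt_norm {ρ : ℝ} (hf : ∀ z, ρ < ‖z‖ → f z = 0) :
    HasCompactSupport f := by
  refine HasCompactSupport.intro (isCompact_closedBall 0 ρ) fun z hz => hf z ?_
  simpa using hz

theorem dirD_dirD_apply {x : EuclideanSpace ℝ (Fin n)} (hf : ContDiffAt ℝ 2 f x)
    (a b : EuclideanSpace ℝ (Fin n)) :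
    dirD a (dirD b f) x = fderiv ℝ (fderiv ℝ f) x a b := by
  have hd : DifferentiableAt ℝ (fderiv ℝ f) x :=
    (hf.fderiv_right (m := 1) (by norm_num)).differentiableAt (by norm_num)
  unfold dirD
  rw [fderiv_clm_apply hd (differentiableAt_const b)]
  simp

theorem dirD_comm (hf : ContDiff ℝ 2 f) (a b : EuclideanSpace ℝ (Fin n)) :
    dirD a (dirD b f) = dirD b (dirD a f) := by
  ext x
  rw [dirD_dirD_apply hf.contDiffAt, dirD_dirD_apply hf.contDiffAt]
  exact hf.contDiffAt.isSymmSndFDerivAt (by simp) a b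

theorem fderiv_eq_sum_dirD (f : EuclideanSpace ℝ (Fin n) → ℝ) (x z : EuclideanSpace ℝ (Fin n)) :
    fderiv ℝ f x z = ∑ k, z k * dirD (EuclideanSpace.single k 1) f x := by
  have hz : z = ∑ k, z k • EuclideanSpace.single k (1 : ℝ) := by
    simpa using ((EuclideanSpace.basisFun (Fin n) ℝ).sum_repr z).symm
  conv_lhs => rw [hz]
  simp [dirD]

theorem integral_mul_dirD (hp : ContDiff ℝ 1 p) (hq : ContDiff ℝ 1 q) (hqc : HasCompactSupport q)
    (e : EuclideanSpace ℝ (Fin n)) :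
    ∫ z, p z * dirD e q z = -∫ z, dirD e p z * q z := by
  have hp' : Continuous (dirD e p) := (hp.dirD (k := 0) (by norm_num) e).continuous
  have hq' : Continuous (dirD e q) := (hq.dirD (k := 0) (by norm_num) e).continuous
  refine integral_mul_fderiv_eq_neg_fderiv_mul_of_integrable ?_ ?_ ?_
    (fun x _ => hp.differentiable (by norm_num) x) (fun x _ => hq.differentiable (by norm_num) x)
  · exact (hp'.mul hq.continuous).integrable_of_hasCompactSupport hqc.mul_left
  · exact (hp.continuous.mul hq').integrable_of_hasCompactSupport (hqc.dirD e).mul_left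
  · exact (hp.continuous.mul hq.continuous).integrable_of_hasCompactSupport hqc.mul_left

theorem dirD_comp_sub_smul (hp : ContDiff ℝ 1 p) (x e z : EuclideanSpace ℝ (Fin n)) (t : ℝ) :
    dirD e (fun z => p (x - t • z)) z = -(t * dirD e p (x - t • z)) := by
  have h1 : HasFDerivAt (fun z : EuclideanSpace ℝ (Fin n) => x - t • z)
      (-(t • ContinuousLinearMap.id ℝ (EuclideanSpace ℝ (Fin n)))) z :=
    ((hasFDerivAt_id z).const_smul t).const_sub x
  have h2 := ((hp.differentiable (by norm_num) (x - t • z)).hasFDerivAt).comp z h1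
  have h3 : fderiv ℝ (fun z => p (x - t • z)) z = _ := h2.fderiv
  simp [dirD, h3]

theorem mul_integral_dirD_comp (hp : ContDiff ℝ 1 p) (hq : ContDiff ℝ 1 q)
    (hqc : HasCompactSupport q) (x e : EuclideanSpace ℝ (Fin n)) (t : ℝ) :
    t * ∫ z, dirD e p (x - t • z) * q z = ∫ z, p (x - t • z) * dirD e q z := by
  have h : ContDiff ℝ 1 fun z : EuclideanSpace ℝ (Fin n) => p (x - t • z) := by fun_prop
  rw [integral_mul_dirD h hq hqc, ← integral_neg, ← integral_const_mul]
  congr 1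
  ext z
  rw [dirD_comp_sub_smul hp]
  ring

theorem integral_dirD_comp_mul_dirD_swap (hp : ContDiff ℝ 1 p) (hq : ContDiff ℝ 2 q)
    (hqc : HasCompactSupport q) (x a b : EuclideanSpace ℝ (Fin n)) {t : ℝ} (ht : t ≠ 0) :
    ∫ z, dirD a p (x - t • z) * dirD b q z = ∫ z, dirD b p (x - t • z) * dirD a q z := by
  apply mul_left_cancel₀ ht
  have hq' (e) : ContDiff ℝ 1 (dirD e q) := hq.dirD (k := 1) (m := 2) (by norm_num) e
  rw [mul_integral_dirD_comp hp (hq' b) (hqc.dirD b), mul_integral_dirD_comp hp (hq' a) (hqc.dirD a),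
    dirD_comm hq]

theorem continuous_integral_comp_sub_smul (hp : Continuous p) (hpc : HasCompactSupport p)
    (hq : Continuous q) (hqc : HasCompactSupport q) (x : EuclideanSpace ℝ (Fin n)) :
    Continuous fun t : ℝ => ∫ z, p (x - t • z) * q z := by
  obtain ⟨M, hM⟩ := hpc.exists_bound_of_continuous hp
  refine continuous_of_dominated (bound := fun z => M * ‖q z‖) (fun t => ?_) (fun t => ?_) ?_ ?_
  · exact Continuous.aestronglyMeasurable (by fun_prop)
  · refine Eventually.of_forall fun z => ?_
    rw [norm_mul]
    exact mul_le_mul_of_nonneg_right (hM _) (norm_nonneg _)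
  · exact (hq.integrable_of_hasCompactSupport hqc).norm.const_mul M
  · exact Eventually.of_forall fun z => by fun_prop

theorem hasDerivAt_integral_comp_sub_smul (hp : ContDiff ℝ 1 p) (hpc : HasCompactSupport p)
    (hq : Continuous q) (hqc : HasCompactSupport q) (x : EuclideanSpace ℝ (Fin n)) (t : ℝ) :
    HasDerivAt (fun t : ℝ => ∫ z, p (x - t • z) * q z)
      (-∫ z, fderiv ℝ p (x - t • z) z * q z) t := by
  have hp' : Continuous (fderiv ℝ p) := hp.continuous_fderiv (by norm_num)
  obtain ⟨M, hM⟩ := (hpc.fderiv ℝ).exists_bound_of_continuous hp'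
  rw [← integral_neg]
  refine (hasDerivAt_integral_of_dominated_loc_of_deriv_le
    (F := fun (t : ℝ) (z : EuclideanSpace ℝ (Fin n)) => p (x - t • z) * q z)
    (F' := fun t z => -(fderiv ℝ p (x - t • z) z * q z))
    (bound := fun z => M * ‖‖z‖ * q z‖) univ_mem ?_ ?_ ?_ ?_ ?_ ?_).2
  · have := hp.continuous
    exact Eventually.of_forall fun t => Continuous.aestronglyMeasurable (by fun_prop)
  · have := hp.continuous
    exact Continuous.integrable_of_hasCompactSupport (by fun_prop) hqc.mul_left
  · exact Continuous.aestronglyMeasurable (by fun_prop)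
  · refine Eventually.of_forall fun z t _ => ?_
    rw [norm_neg, norm_mul, norm_mul, norm_norm, ← mul_assoc]
    refine mul_le_mul_of_nonneg_right ?_ (norm_nonneg _)
    exact (ContinuousLinearMap.le_opNorm _ _).trans
      (mul_le_mul_of_nonneg_right (hM _) (norm_nonneg _))
  · exact (Continuous.integrable_of_hasCompactSupport (by fun_prop) hqc.mul_left).norm.const_mul M
  · refine Eventually.of_forall fun z t _ => ?_
    have h1 : HasDerivAt (fun t : ℝ => x - t • z) (-z) t := by
      simpa using ((hasDerivAt_id t).smul_const z).const_sub x
    have h2 := ((hp.differentiable (by norm_num) (x - t • z)).hasFDerivAt).comp_hasDerivAt t h1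
    simpa using h2.mul_const (q z)

end DirectionalDerivative

/-- A pair of smooth kernels `φ`, `ψ` supported in the ball of radius `1/2` such that `φ` has
integral one and `z φ(z) = -a ∇ψ(z)`; thus `L ψ = -div (z φ)` for `L = ∑ aᵢⱼ ∂ᵢ∂ⱼ`. -/
structure IsKernelPair {n : ℕ} (a : Fin n → Fin n → ℝ)
    (φ ψ : EuclideanSpace ℝ (Fin n) → ℝ) : Prop where
  smooth_fst : ContDiff ℝ (⊤ : ℕ∞) φ
  smooth_snd : ContDiff ℝ (⊤ : ℕ∞) ψ
  fst_eq_zero : ∀ z, 1 / 2 < ‖z‖ → φ z = 0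
  snd_eq_zero : ∀ z, 1 / 2 < ‖z‖ → ψ z = 0
  integral_fst : ∫ z, φ z = 1
  flux : ∀ k z, z k * φ z = -∑ l, a k l * dirD (EuclideanSpace.single l 1) ψ z

section Kernel

variable {n : ℕ} {a : Fin n → Fin n → ℝ} {φ ψ v : EuclideanSpace ℝ (Fin n) → ℝ}

theorem IsKernelPair.mul_dirD_fst (h : IsKernelPair a φ ψ) (i k : Fin n)
    (z : EuclideanSpace ℝ (Fin n)) :
    z k * dirD (EuclideanSpace.single i 1) φ z =
      -(∑ l, a k l * dirD (EuclideanSpace.single i 1)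
        (dirD (EuclideanSpace.single l 1) ψ) z) - if k = i then φ z else 0 := by
  have hφ : DifferentiableAt ℝ φ z := h.smooth_fst.differentiable (by simp) z
  have hψ (l : Fin n) : DifferentiableAt ℝ (dirD (EuclideanSpace.single l 1) ψ) z :=
    (h.smooth_snd.dirD (k := 1) (by simp) _).differentiable (by simp) z
  have hk : HasFDerivAt (fun z : EuclideanSpace ℝ (Fin n) => z k)
      (EuclideanSpace.proj k : EuclideanSpace ℝ (Fin n) →L[ℝ] ℝ) z :=
    (EuclideanSpace.proj k : EuclideanSpace ℝ (Fin n) →L[ℝ] ℝ).hasFDerivAt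
  have h1 := hk.mul hφ.hasFDerivAt
  have h2 := (HasFDerivAt.fun_sum (u := Finset.univ)
    (fun l _ => (hψ l).hasFDerivAt.const_mul (a k l))).neg
  have h3 : (fun z : EuclideanSpace ℝ (Fin n) => z k * φ z) =
      fun z => -∑ l, a k l * dirD (EuclideanSpace.single l 1) ψ z := funext (h.flux k)
  have h4 := congrArg (fun A => A (EuclideanSpace.single i 1))
    (h1.unique (by rw [show ((fun z : EuclideanSpace ℝ (Fin n) => z k) * φ) = _ from h3]; exact h2))
  have h5 : z k * fderiv ℝ φ z (EuclideanSpace.single i 1) + (φ z * if k = i then 1 else 0) =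
      -∑ l, a k l * fderiv ℝ (dirD (EuclideanSpace.single l 1) ψ) z (EuclideanSpace.single i 1) := by
    simpa [Pi.single_apply] using h4
  unfold dirD at h5 ⊢
  split_ifs at h5 ⊢ <;> linarith

theorem IsKernelPair.hasDerivAt_average (h : IsKernelPair a φ ψ) (hv : ContDiff ℝ 2 v)
    (hvc : HasCompactSupport v) (i j : Fin n) (x : EuclideanSpace ℝ (Fin n)) {t : ℝ} (ht : t ≠ 0) :
    HasDerivAt (fun t : ℝ => ∫ z, dirD (EuclideanSpace.single i 1)
        (dirD (EuclideanSpace.single j 1) v) (x - t • z) * φ z)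
      (t⁻¹ * ∫ z, (∑ k, ∑ l, a k l * dirD (EuclideanSpace.single k 1)
        (dirD (EuclideanSpace.single l 1) v) (x - t • z)) *
          dirD (EuclideanSpace.single j 1) (dirD (EuclideanSpace.single i 1) ψ) z) t := by
  set e : Fin n → EuclideanSpace ℝ (Fin n) := fun k => EuclideanSpace.single k 1 with he
  have hp (k) : ContDiff ℝ 1 (dirD (e k) v) := hv.dirD (k := 1) (m := 2) (by norm_num) _
  have hpc (k) : HasCompactSupport (dirD (e k) v) := hvc.dirD _
  have hg (k l) : Continuous (dirD (e k) (dirD (e l) v)) :=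
    ((hp l).dirD (k := 0) (by norm_num) _).continuous
  have hφ : ContDiff ℝ 1 φ := h.smooth_fst.of_le (by simp)
  have hφc : HasCompactSupport φ := hasCompactSupport_of_lt_norm h.fst_eq_zero
  have hφ' : Continuous (dirD (e i) φ) := (hφ.dirD (k := 0) (by norm_num) _).continuous
  have hψc : HasCompactSupport ψ := hasCompactSupport_of_lt_norm h.snd_eq_zero
  have hψ2 (k) : ContDiff ℝ 2 (dirD (e k) ψ) := h.smooth_snd.dirD (k := 2) (by simp) _
  have hψ' (k l) : Continuous (dirD (e k) (dirD (e l) ψ)) :=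
    ((hψ2 l).dirD (k := 0) (m := 2) (by norm_num) _).continuous
  have hint (k l k' l') : Integrable fun z => dirD (e k) (dirD (e l) v) (x - t • z) *
      dirD (e k') (dirD (e l') ψ) z := by
    have := hg k l
    have := hψ' k' l'
    exact Continuous.integrable_of_hasCompactSupport (by fun_prop)
      ((hψc.dirD _).dirD _).mul_left
  have hN := hasDerivAt_integral_comp_sub_smul (hp j) (hpc j) hφ' (hφc.dirD _) x t
  have hG := (hasDerivAt_inv ht).mul hN
  have hN' : -∫ z, fderiv ℝ (dirD (e j) v) (x - t • z) z * dirD (e i) φ z =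
      (∫ z, (∑ k, ∑ l, a k l * dirD (e k) (dirD (e l) v) (x - t • z)) *
          dirD (e j) (dirD (e i) ψ) z) +
        ∫ z, dirD (e i) (dirD (e j) v) (x - t • z) * φ z := by
    have h1 (z : EuclideanSpace ℝ (Fin n)) :
        -(fderiv ℝ (dirD (e j) v) (x - t • z) z * dirD (e i) φ z) =
          (∑ k, ∑ l, a k l * (dirD (e j) (dirD (e k) v) (x - t • z) *
            dirD (e l) (dirD (e i) ψ) z)) +
          dirD (e i) (dirD (e j) v) (x - t • z) * φ z := by
      rw [fderiv_eq_sum_dirD, Finset.sum_mul]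
      have h2 (k : Fin n) : z k * dirD (e k) (dirD (e j) v) (x - t • z) * dirD (e i) φ z =
          -(∑ l, a k l * (dirD (e j) (dirD (e k) v) (x - t • z) *
            dirD (e l) (dirD (e i) ψ) z)) -
          if k = i then dirD (e k) (dirD (e j) v) (x - t • z) * φ z else 0 := by
        have h3 := h.mul_dirD_fst i k z
        have h4 (l) : dirD (e l) (dirD (e i) ψ) = dirD (e i) (dirD (e l) ψ) :=
          dirD_comm (h.smooth_snd.of_le (WithTop.coe_le_coe.2 (le_top : (2 : ℕ∞) ≤ ⊤))) _ _
        simp only [h4, dirD_comm hv (e j) (e k)]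
        rw [mul_right_comm, h3, sub_mul, neg_mul, Finset.sum_mul]
        congr 1
        · congr 1
          exact Finset.sum_congr rfl fun l _ => by ring
        · split_ifs <;> ring
      rw [Finset.sum_congr rfl fun k _ => h2 k]
      simp only [Finset.sum_sub_distrib, Finset.sum_neg_distrib, Finset.sum_ite_eq',
        Finset.mem_univ, if_true]
      ring
    rw [← integral_neg, funext h1, integral_add, integral_finsetSum]
    · congr 1
      have h5 : (fun z => (∑ k, ∑ l, a k l * dirD (e k) (dirD (e l) v) (x - t • z)) *
          dirD (e j) (dirD (e i) ψ) z) = fun z => ∑ k, ∑ l, a k l *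
            (dirD (e l) (dirD (e k) v) (x - t • z) * dirD (e j) (dirD (e i) ψ) z) := by
        ext z
        simp only [Finset.sum_mul, mul_assoc]
        refine Finset.sum_congr rfl fun k _ => Finset.sum_congr rfl fun l _ => ?_
        rw [dirD_comm hv (e k) (e l)]
      rw [h5, integral_finsetSum]
      · refine Finset.sum_congr rfl fun k _ => ?_
        rw [integral_finsetSum, integral_finsetSum]
        · refine Finset.sum_congr rfl fun l _ => ?_
          rw [integral_const_mul, integral_const_mul,
            integral_dirD_comp_mul_dirD_swap (hp k) (hψ2 i) (hψc.dirD _) x _ _ ht]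
        · exact fun l _ => (hint _ _ _ _).const_mul _
        · exact fun l _ => (hint _ _ _ _).const_mul _
      · exact fun k _ => integrable_finsetSum _ fun l _ => (hint _ _ _ _).const_mul _
    · exact fun k _ => integrable_finsetSum _ fun l _ => (hint _ _ _ _).const_mul _
    · exact integrable_finsetSum _ fun k _ => integrable_finsetSum _ fun l _ =>
        (hint _ _ _ _).const_mul _
    · have := hg i j
      have := hφ.continuous
      exact Continuous.integrable_of_hasCompactSupport (by fun_prop) hφc.mul_left
  rw [hN'] at hG
  refine (hG.congr_deriv ?_).congr_of_eventuallyEq ?_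
  · rw [← mul_integral_dirD_comp (hp j) hφ hφc]
    field_simp
    ring
  · filter_upwards [isOpen_ne.mem_nhds ht] with s hs
    simp only [Pi.mul_apply]
    rw [← mul_integral_dirD_comp (hp j) hφ hφc, inv_mul_cancel_left₀ hs]

end Kernel

section Estimates

variable {n : ℕ}

theorem abs_sub_le_integral_of_hasDerivAt {g g' b : ℝ → ℝ} {s t : ℝ} (hst : s ≤ t)
    (hg : Continuous g) (hderiv : ∀ τ ∈ Ioo s t, HasDerivAt g (g' τ) τ)
    (hb : IntervalIntegrable b volume s t) (hgb : ∀ τ ∈ Ioo s t, |g' τ| ≤ b τ) :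
    |g t - g s| ≤ ∫ τ in s..t, b τ := by
  have hb' : IntegrableOn b (Icc s t) := (intervalIntegrable_iff_integrableOn_Icc_of_le hst).1 hb
  refine abs_le'.2 ⟨?_, ?_⟩
  · exact intervalIntegral.sub_le_integral_of_hasDeriv_right_of_le hst hg.continuousOn
      (fun τ hτ => (hderiv τ hτ).hasDerivWithinAt) hb' fun τ hτ => (le_abs_self _).trans (hgb τ hτ)
  · have := intervalIntegral.sub_le_integral_of_hasDeriv_right_of_le hst hg.neg.continuousOn
      (fun τ hτ => (hderiv τ hτ).neg.hasDerivWithinAt) hb'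
      fun τ hτ => (neg_le_abs _).trans (hgb τ hτ)
    simp only [Pi.neg_apply] at this
    linarith

theorem integrable_comp_sub_smul_mul {F H : EuclideanSpace ℝ (Fin n) → ℝ} (hF : Continuous F)
    (hH : Continuous H) (hHc : HasCompactSupport H) (x : EuclideanSpace ℝ (Fin n)) (t : ℝ) :
    Integrable fun z => F (x - t • z) * H z :=
  Continuous.integrable_of_hasCompactSupport (by fun_prop) hHc.mul_left

theorem integral_comp_sub_smul_sub_const_mul {F H : EuclideanSpace ℝ (Fin n) → ℝ}
    (hF : Continuous F) (hH : Continuous H) (hHc : HasCompactSupport H) (hHint : ∫ z, H z = 0)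
    (x : EuclideanSpace ℝ (Fin n)) (t c : ℝ) :
    ∫ z, (F (x - t • z) - c) * H z = ∫ z, F (x - t • z) * H z := by
  simp only [sub_mul]
  rw [integral_sub (integrable_comp_sub_smul_mul hF hH hHc x t)
    ((hH.integrable_of_hasCompactSupport hHc).const_mul c), integral_const_mul, hHint, mul_zero,
    sub_zero]

theorem abs_integral_comp_sub_smul_sub_le {F H : EuclideanSpace ℝ (Fin n) → ℝ} {ℓ : NNReal}
    (hF : Continuous F) (hH : LipschitzWith ℓ H) (hH0 : ∀ z, 1 / 2 < ‖z‖ → H z = 0)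
    {x y : EuclideanSpace ℝ (Fin n)} {t S : ℝ} (ht : 0 < t) (hxy : dist x y ≤ t / 2)
    (hS : ∀ p ∈ closedBall x t, |F p| ≤ S) :
    |(∫ z, F (x - t • z) * H z) - ∫ z, F (y - t • z) * H z| ≤
      S * ℓ * volume.real (closedBall (0 : EuclideanSpace ℝ (Fin n)) 1) * (dist x y / t) := by
  have hHc : HasCompactSupport H := hasCompactSupport_of_lt_norm hH0
  have hH' := hH.continuous
  set h : EuclideanSpace ℝ (Fin n) := t⁻¹ • (y - x) with hh
  have hnorm : ‖h‖ = dist x y / t := by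
    rw [hh, norm_smul, norm_inv, Real.norm_of_nonneg ht.le, dist_comm, dist_eq_norm, div_eq_inv_mul]
  have hnorm' : ‖h‖ ≤ 1 / 2 := by
    rw [hnorm, div_le_iff₀ ht]
    linarith
  have hshift : ∫ z, F (y - t • z) * H z = ∫ z, F (x - t • z) * H (z + h) := by
    rw [← integral_add_right_eq_self _ h]
    congr 1
    ext z
    have : y - t • (z + h) = x - t • z := by
      rw [hh, smul_add, smul_smul, mul_inv_cancel₀ ht.ne', one_smul]
      abel
    rw [this]
  have hc2 : HasCompactSupport fun z => H (z + h) :=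
    hHc.comp_homeomorph (Homeomorph.addRight h)
  rw [hshift, ← integral_sub (integrable_comp_sub_smul_mul hF hH' hHc x t)
    (integrable_comp_sub_smul_mul hF (by fun_prop) hc2 x t)]
  rw [← setIntegral_eq_integral_of_forall_compl_eq_zero (s := closedBall 0 1)]
  · have hS0 : 0 ≤ S := (abs_nonneg _).trans (hS x (mem_closedBall_self ht.le))
    have := norm_setIntegral_le_of_norm_le_const (μ := volume)
      (s := closedBall (0 : EuclideanSpace ℝ (Fin n)) 1)
      (f := fun z => F (x - t • z) * H z - F (x - t • z) * H (z + h))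
      (C := S * (ℓ * (dist x y / t))) measure_closedBall_lt_top fun z hz => by
        rw [← mul_sub, norm_mul]
        have h1 : ‖z‖ ≤ 1 := by simpa using hz
        refine mul_le_mul (hS _ ?_) ?_ (norm_nonneg _) hS0
        · rw [mem_closedBall, dist_eq_norm, sub_sub_cancel_left, norm_neg, norm_smul,
            Real.norm_of_nonneg ht.le]
          nlinarith
        · have := hH.dist_le_mul z (z + h)
          rwa [dist_eq_norm, dist_self_add_right, hnorm] at this
    rw [Real.norm_eq_abs] at this
    refine this.trans (le_of_eq (by ring))
  · intro z hz
    have h1 : 1 < ‖z‖ := by simpa using hz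
    have h2 : 1 / 2 < ‖z + h‖ := by
      have := norm_sub_le (z + h) h
      rw [add_sub_cancel_right] at this
      linarith
    rw [hH0 z (by linarith), hH0 _ h2]
    ring

theorem abs_integral_comp_sub_smul_le {F H : EuclideanSpace ℝ (Fin n) → ℝ}
    (hF : Continuous F) (hH : Continuous H) (hH0 : ∀ z, 1 / 2 < ‖z‖ → H z = 0)
    (hHint : ∫ z, H z = 0) {x : EuclideanSpace ℝ (Fin n)} {t S : ℝ} (ht : 0 ≤ t)
    (hS : ∀ p ∈ closedBall x (t / 2), |F p - F x| ≤ S) :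
    |∫ z, F (x - t • z) * H z| ≤ S * ∫ z, |H z| := by
  have hHc : HasCompactSupport H := hasCompactSupport_of_lt_norm hH0
  have hHi : Integrable H := hH.integrable_of_hasCompactSupport hHc
  rw [← integral_comp_sub_smul_sub_const_mul hF hH hHc hHint x t (F x), ← integral_const_mul,
    ← Real.norm_eq_abs]
  refine norm_integral_le_of_norm_le (hHi.abs.const_mul S) (Eventually.of_forall fun z => ?_)
  rw [norm_mul, Real.norm_eq_abs, Real.norm_eq_abs]
  rcases le_or_gt ‖z‖ (1 / 2) with hz | hz
  · refine mul_le_mul_of_nonneg_right (hS _ ?_) (abs_nonneg _)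
    rw [mem_closedBall, dist_eq_norm, sub_sub_cancel_left, norm_neg, norm_smul,
      Real.norm_of_nonneg ht]
    nlinarith
  · simp [hH0 z hz]

theorem IsKernelPair.abs_dirD_dirD_sub_le {a : Fin n → Fin n → ℝ}
    {φ ψ v : EuclideanSpace ℝ (Fin n) → ℝ} (h : IsKernelPair a φ ψ) (hv : ContDiff ℝ 2 v)
    (hvc : HasCompactSupport v) (i j : Fin n) {ℓφ ℓψ : NNReal} (hℓφ : LipschitzWith ℓφ φ)
    (hℓψ : LipschitzWith ℓψ (dirD (EuclideanSpace.single j 1) (dirD (EuclideanSpace.single i 1) ψ)))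
    {R : ℝ} {ω : ℝ → ℝ} (hω : IsOsc ω R) (hdini : IntegrableOn (fun s => ω s / s) (Set.Ioc 0 R))
    {K : Set (EuclideanSpace ℝ (Fin n))} {x y : EuclideanSpace ℝ (Fin n)} {T S M : ℝ}
    (hxy : x ≠ y) (hT : 2 * dist x y ≤ T) (hTR : T < R)
    (hxK : closedBall x T ⊆ K) (hyK : closedBall y T ⊆ K)
    (hM : ∀ p ∈ K, |dirD (EuclideanSpace.single i 1) (dirD (EuclideanSpace.single j 1) v) p| ≤ M)
    (hS : ∀ p ∈ K, ∀ q ∈ K, ∀ τ ∈ Ioo 0 R, dist p q ≤ τ →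
      |(∑ k, ∑ l, a k l * dirD (EuclideanSpace.single k 1) (dirD (EuclideanSpace.single l 1) v) p) -
        ∑ k, ∑ l, a k l * dirD (EuclideanSpace.single k 1)
          (dirD (EuclideanSpace.single l 1) v) q| ≤ S * ω τ) :
    |dirD (EuclideanSpace.single i 1) (dirD (EuclideanSpace.single j 1) v) x -
        dirD (EuclideanSpace.single i 1) (dirD (EuclideanSpace.single j 1) v) y| ≤
      S * (2 * ∫ z, |dirD (EuclideanSpace.single j 1) (dirD (EuclideanSpace.single i 1) ψ) z|) *
          (∫ s in (0 : ℝ)..dist x y, ω s / s) +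
        S * ℓψ * volume.real (closedBall (0 : EuclideanSpace ℝ (Fin n)) 1) *
          (dist x y * ∫ s in (dist x y)..R, ω s / s ^ 2) +
        M * ℓφ * volume.real (closedBall (0 : EuclideanSpace ℝ (Fin n)) 1) * (dist x y / T) := by
  set e : Fin n → EuclideanSpace ℝ (Fin n) := fun k => EuclideanSpace.single k 1
  set g := dirD (e i) (dirD (e j) v)
  set H := dirD (e j) (dirD (e i) ψ)
  set F : EuclideanSpace ℝ (Fin n) → ℝ :=
    fun x => ∑ k, ∑ l, a k l * dirD (e k) (dirD (e l) v) x
  set r := dist x y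
  set V := volume.real (closedBall (0 : EuclideanSpace ℝ (Fin n)) 1)
  set I := ∫ z, |H z|
  have hr : 0 < r := dist_pos.2 hxy
  have hV : 0 ≤ V := measureReal_nonneg
  have hI : 0 ≤ I := integral_nonneg fun z => abs_nonneg _
  have hg2 (k l) : Continuous (dirD (e k) (dirD (e l) v)) :=
    ((hv.dirD (k := 1) (m := 2) (by norm_num) _).dirD (k := 0) (by norm_num) _).continuous
  have hgc : HasCompactSupport g := (hvc.dirD _).dirD _
  have hF : Continuous F := by
    have := hg2
    fun_prop
  have hφ : Continuous φ := h.smooth_fst.continuous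
  have hφc : HasCompactSupport φ := hasCompactSupport_of_lt_norm h.fst_eq_zero
  have hH : Continuous H := hℓψ.continuous
  have hH0 : ∀ z, 1 / 2 < ‖z‖ → H z = 0 :=
    dirD_eq_zero_of_lt_norm (dirD_eq_zero_of_lt_norm h.snd_eq_zero _) _
  have hHint : ∫ z, H z = 0 := by
    have := integral_mul_dirD (p := fun _ => 1) (q := dirD (e i) ψ) contDiff_const
      (h.smooth_snd.dirD (k := 1) (by simp) _)
      ((hasCompactSupport_of_lt_norm h.snd_eq_zero).dirD _) (e j)
    simpa [dirD, H] using this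
  set G : EuclideanSpace ℝ (Fin n) → ℝ → ℝ := fun x t => ∫ z, g (x - t • z) * φ z
  set D : ℝ → ℝ := fun t => G x t - G y t
  set J : EuclideanSpace ℝ (Fin n) → ℝ → ℝ := fun x t => ∫ z, F (x - t • z) * H z
  have hD : Continuous D := by
    exact (continuous_integral_comp_sub_smul (hg2 i j) hgc hφ hφc x).sub
      (continuous_integral_comp_sub_smul (hg2 i j) hgc hφ hφc y)
  have hD' (t : ℝ) (ht : 0 < t) : HasDerivAt D (t⁻¹ * (J x t - J y t)) t := by
    rw [mul_sub]
    exact (h.hasDerivAt_average hv hvc i j x ht.ne').sub (h.hasDerivAt_average hv hvc i j y ht.ne')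
  have hD0 : D 0 = g x - g y := by
    simp [D, G, integral_const_mul, h.integral_fst]
  have hDT : |D T| ≤ M * ℓφ * V * (r / T) :=
    abs_integral_comp_sub_smul_sub_le (hg2 i j) hℓφ h.fst_eq_zero (by linarith)
      (by linarith) fun p hp => hM p (hxK hp)
  have hωr : IntervalIntegrable (fun s => ω s / s) volume 0 r :=
    (intervalIntegrable_iff_integrableOn_Ioc_of_le hr.le).2
      (hdini.mono_set (Ioc_subset_Ioc_right (by linarith)))
  have hsmall : |D (2 * r) - D 0| ≤ S * (2 * I) * ∫ s in (0 : ℝ)..r, ω s / s := by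
    have h1 : ∫ t in (0 : ℝ)..(2 * r), S * I * (ω (t / 2) / (t / 2)) =
        S * (2 * I) * ∫ s in (0 : ℝ)..r, ω s / s := by
      rw [intervalIntegral.integral_const_mul,
        intervalIntegral.integral_comp_div (fun s => ω s / s) two_ne_zero]
      simp
      ring
    rw [← h1]
    refine abs_sub_le_integral_of_hasDerivAt (by linarith) hD (fun t ht => hD' t ht.1) ?_ ?_
    · refine IntervalIntegrable.const_mul ?_ _
      have := hωr.comp_mul_left (c := 1 / 2)
      simpa [div_eq_inv_mul, mul_comm] using this
    · intro t ht
      have ht0 : 0 < t := ht.1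
      have htR : t / 2 ∈ Ioo 0 R := ⟨by linarith, by linarith [ht.2]⟩
      have key (w) (hw : closedBall w T ⊆ K) : |J w t| ≤ S * ω (t / 2) * I := by
        refine abs_integral_comp_sub_smul_le hF hH hH0 hHint ht0.le fun p hp => ?_
        refine hS p (hw ?_) w (hw (mem_closedBall_self (by linarith))) _ htR hp
        exact closedBall_subset_closedBall (by linarith [ht.2]) hp
      rw [abs_mul, abs_of_pos (inv_pos.2 ht0)]
      calc t⁻¹ * |J x t - J y t| ≤ t⁻¹ * (S * ω (t / 2) * I + S * ω (t / 2) * I) := by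
            gcongr
            exact (abs_sub _ _).trans (add_le_add (key x hxK) (key y hyK))
        _ = S * I * (ω (t / 2) / (t / 2)) := by
            field_simp
            ring
  have hω2 : IntervalIntegrable (fun s => ω s / s ^ 2) volume r R := by
    refine ContinuousOn.intervalIntegrable ?_
    rw [uIcc_of_le (by linarith)]
    refine (hω.cont.mono (Icc_subset_Icc_left hr.le)).div (by fun_prop) fun s hs => ?_
    have := hr.trans_le hs.1
    positivity
  have hSω (t : ℝ) (ht : 0 < t) (htR : t < R) : 0 ≤ S * ω t := by
    have hx := hxK (mem_closedBall_self (by linarith))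
    exact (abs_nonneg _).trans (hS x hx x hx t ⟨ht, htR⟩ (by simpa using ht.le))
  have hS0 : 0 ≤ S :=
    nonneg_of_mul_nonneg_left (hSω r hr (by linarith)) (hω.pos r hr (by linarith))
  have hlarge : |D T - D (2 * r)| ≤ S * ℓψ * V * (r * ∫ s in r..R, ω s / s ^ 2) := by
    have hsub : uIcc (2 * r) T ⊆ uIcc r R := by
      rw [uIcc_of_le hT, uIcc_of_le (by linarith)]
      exact Icc_subset_Icc (by linarith) hTR.le
    have h1 : |D T - D (2 * r)| ≤ ∫ t in (2 * r)..T, S * ℓψ * V * r * (ω t / t ^ 2) := by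
      refine abs_sub_le_integral_of_hasDerivAt hT hD (fun t ht => hD' t (by linarith [ht.1])) ?_ ?_
      · exact (hω2.mono_set hsub).const_mul _
      · intro t ht
        have ht0 : 0 < t := by linarith [ht.1]
        have hsubx : J x t - J y t = (∫ z, (F (x - t • z) - F x) * H z) -
            ∫ z, (F (y - t • z) - F x) * H z := by
          have hHc := hasCompactSupport_of_lt_norm hH0
          rw [integral_comp_sub_smul_sub_const_mul hF hH hHc hHint,
            integral_comp_sub_smul_sub_const_mul hF hH hHc hHint]
        have h2 : |J x t - J y t| ≤ S * ω t * ℓψ * V * (r / t) := by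
          rw [hsubx]
          refine abs_integral_comp_sub_smul_sub_le (F := fun p => F p - F x) (by fun_prop) hℓψ hH0
            ht0 (by linarith [ht.1]) fun p hp => ?_
          refine hS p (hxK ?_) x (hxK (mem_closedBall_self (by linarith))) t
            ⟨ht0, by linarith [ht.2]⟩ hp
          exact closedBall_subset_closedBall ht.2.le hp
        rw [abs_mul, abs_of_pos (inv_pos.2 ht0)]
        calc t⁻¹ * |J x t - J y t| ≤ t⁻¹ * (S * ω t * ℓψ * V * (r / t)) := by gcongr
          _ = S * ℓψ * V * r * (ω t / t ^ 2) := by field_simp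
    refine h1.trans ?_
    rw [intervalIntegral.integral_const_mul, ← mul_assoc (S * ℓψ * V)]
    refine mul_le_mul_of_nonneg_left ?_ (by positivity)
    refine intervalIntegral.integral_mono_interval (by linarith) hT hTR.le ?_ hω2
    filter_upwards [ae_restrict_mem measurableSet_Ioc] with s hs
    have := hr.trans hs.1
    have := (hω.pos s this hs.2).le
    simp only [Pi.zero_apply]
    positivity
  have e1 : |D 0| ≤ |D (2 * r) - D 0| + |D T - D (2 * r)| + |D T| := by
    have h1 := neg_abs_le (D (2 * r) - D 0)
    have h2 := le_abs_self (D (2 * r) - D 0)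
    have h3 := neg_abs_le (D T - D (2 * r))
    have h4 := le_abs_self (D T - D (2 * r))
    have h5 := neg_abs_le (D T)
    have h6 := le_abs_self (D T)
    exact abs_le.2 ⟨by linarith, by linarith⟩
  rw [← hD0]
  linarith

end Estimates

section KernelExistence

variable {n : ℕ}

theorem exists_inverse_of_coercive {a : Fin n → Fin n → ℝ} {ν : ℝ} (hν : 0 < ν)
    (hsymm : ∀ i j, a i j = a j i)
    (hell : ∀ ξ : EuclideanSpace ℝ (Fin n), ν * ‖ξ‖ ^ 2 ≤ ∑ i, ∑ j, a i j * ξ i * ξ j) :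
    ∃ B : EuclideanSpace ℝ (Fin n) →L[ℝ] EuclideanSpace ℝ (Fin n),
      (∀ z k, ∑ l, a k l * B z l = z k) ∧ (∀ z w, inner ℝ (B z) w = inner ℝ z (B w)) ∧
      ∃ c > 0, ∀ z, c * ‖z‖ ^ 2 ≤ inner ℝ (B z) z := by
  set A : EuclideanSpace ℝ (Fin n) →ₗ[ℝ] EuclideanSpace ℝ (Fin n) :=
    Matrix.toEuclideanLin (Matrix.of a)
  have hA (z k) : A z k = ∑ l, a k l * z l := by
    simp [A, Matrix.toLpLin_apply, Matrix.mulVec, dotProduct]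
  have hAs (z w) : inner ℝ (A z) w = inner ℝ z (A w) := by
    simp only [PiLp.inner_apply, hA, RCLike.inner_apply, conj_trivial, Finset.mul_sum,
      Finset.sum_mul]
    rw [Finset.sum_comm]
    refine Finset.sum_congr rfl fun i _ => Finset.sum_congr rfl fun j _ => ?_
    rw [hsymm i j]
    ring
  have hAe (z) : ν * ‖z‖ ^ 2 ≤ inner ℝ z (A z) := by
    refine (hell z).trans (le_of_eq ?_)
    simp only [PiLp.inner_apply, hA, RCLike.inner_apply, conj_trivial, Finset.sum_mul]
    exact Finset.sum_congr rfl fun i _ => Finset.sum_congr rfl fun j _ => by ring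
  have hinj : Function.Injective A := by
    rw [injective_iff_map_eq_zero]
    intro z hz
    have := hAe z
    rw [hz, inner_zero_right] at this
    have h2 : ‖z‖ ^ 2 ≤ 0 := by
      by_contra! h
      nlinarith
    simpa using le_antisymm h2 (by positivity)
  set B := LinearMap.toContinuousLinearMap (LinearEquiv.ofInjectiveEndo A hinj).symm.toLinearMap
  have hAB (z) : A (B z) = z := (LinearEquiv.ofInjectiveEndo A hinj).apply_symm_apply z
  have hN (z) : ‖z‖ ≤ (‖LinearMap.toContinuousLinearMap A‖ + 1) * ‖B z‖ := by
    have := (LinearMap.toContinuousLinearMap A).le_opNorm (B z)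
    rw [LinearMap.coe_toContinuousLinearMap', hAB] at this
    nlinarith [norm_nonneg (B z)]
  set N := ‖LinearMap.toContinuousLinearMap A‖ + 1
  have hN0 : 0 < N := by positivity
  refine ⟨B, fun z k => by rw [← hA, hAB], fun z w => ?_, ν / N ^ 2, by positivity, fun z => ?_⟩
  · rw [← hAB w, ← hAs, hAB, hAB]
  · have h1 := hAe (B z)
    rw [hAB] at h1
    refine le_trans ?_ h1
    rw [div_mul_eq_mul_div, div_le_iff₀ (by positivity), mul_assoc]
    refine mul_le_mul_of_nonneg_left ?_ hν.le
    rw [← mul_pow, mul_comm]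
    exact pow_le_pow_left₀ (norm_nonneg _) (hN z) 2

theorem expNegInvGlue.hasDerivAt (x : ℝ) :
    HasDerivAt expNegInvGlue ((x⁻¹) ^ 2 * expNegInvGlue x) x := by
  simpa using hasDerivAt_polynomial_eval_inv_mul 1 x

theorem exists_isKernelPair {a : Fin n → Fin n → ℝ} {ν : ℝ} (hν : 0 < ν)
    (hsymm : ∀ i j, a i j = a j i)
    (hell : ∀ ξ : EuclideanSpace ℝ (Fin n), ν * ‖ξ‖ ^ 2 ≤ ∑ i, ∑ j, a i j * ξ i * ξ j) :
    ∃ φ ψ, IsKernelPair a φ ψ := by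
  obtain ⟨B, hAB, hBs, c, hc, hBc⟩ := exists_inverse_of_coercive hν hsymm hell
  set Q : EuclideanSpace ℝ (Fin n) → ℝ := fun z => c / 4 - inner ℝ (B z) z
  have hQ : ContDiff ℝ (⊤ : ℕ∞) Q := contDiff_const.sub (B.contDiff.inner ℝ contDiff_id)
  have hQ' (z w) : HasFDerivAt Q (fderiv ℝ Q z) z ∧ fderiv ℝ Q z w = -(2 * inner ℝ (B z) w) := by
    refine ⟨(hQ.differentiable (by simp) z).hasFDerivAt, ?_⟩
    have h := ((B.hasFDerivAt (x := z)).inner ℝ (hasFDerivAt_id z)).const_sub (c / 4)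
    rw [show fderiv ℝ Q z = _ from h.fderiv]
    have h1 := hBs z w
    have h2 := real_inner_comm z (B w)
    simp [fderivInnerCLM_apply]
    linarith
  have hQ0 (z) (hz : 1 / 2 < ‖z‖) : Q z ≤ 0 := by
    have := hBc z
    have : c * (1 / 2) ^ 2 ≤ c * ‖z‖ ^ 2 := by gcongr
    simp only [Q]
    linarith
  have hcd : ContDiff ℝ (⊤ : ℕ∞) expNegInvGlue := expNegInvGlue.contDiff
  have hcd' : ContDiff ℝ (⊤ : ℕ∞) (deriv expNegInvGlue) := (contDiff_infty_iff_deriv.1 hcd).2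
  have hd (s : ℝ) : deriv expNegInvGlue s = (s⁻¹) ^ 2 * expNegInvGlue s :=
    (expNegInvGlue.hasDerivAt s).deriv
  set φ₀ : EuclideanSpace ℝ (Fin n) → ℝ := fun z => 2 * deriv expNegInvGlue (Q z)
  have hφ₀ : ContDiff ℝ (⊤ : ℕ∞) φ₀ := contDiff_const.mul (hcd'.comp hQ)
  have hφ₀0 (z) (hz : 1 / 2 < ‖z‖) : φ₀ z = 0 := by
    simp [φ₀, hd, hQ0 z hz]
  have hm : 0 < ∫ z, φ₀ z := by
    refine Continuous.integral_pos_of_hasCompactSupport_nonneg_nonzero (x := 0) hφ₀.continuous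
      (hasCompactSupport_of_lt_norm hφ₀0) (fun z => ?_) ?_
    · simp only [φ₀, hd, Pi.zero_apply]
      have := expNegInvGlue.nonneg (Q z)
      positivity
    · simp only [φ₀, hd]
      have h0 : 0 < Q 0 := by simp [Q, hc]
      have := expNegInvGlue.pos_of_pos h0
      positivity
  set m := ∫ z, φ₀ z
  refine ⟨fun z => m⁻¹ * φ₀ z, fun z => m⁻¹ * expNegInvGlue (Q z), contDiff_const.mul hφ₀,
    contDiff_const.mul (hcd.comp hQ), fun z hz => by simp [hφ₀0 z hz],
    fun z hz => by simp [hQ0 z hz], ?_, fun k z => ?_⟩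
  · rw [integral_const_mul, inv_mul_cancel₀ hm.ne']
  · have hdir (l : Fin n) : dirD (EuclideanSpace.single l 1)
        (fun z => m⁻¹ * expNegInvGlue (Q z)) z = -(m⁻¹ * φ₀ z * B z l) := by
      have h1 := ((expNegInvGlue.hasDerivAt (Q z)).comp_hasFDerivAt z (hQ' z 0).1).const_mul m⁻¹
      have h2 : fderiv ℝ (fun z => m⁻¹ * expNegInvGlue (Q z)) z = _ := h1.fderiv
      simp only [dirD, h2, φ₀, hd]
      simp [(hQ' z _).2, EuclideanSpace.inner_single_right]
      ring
    simp only [hdir]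
    rw [← hAB z k, Finset.sum_mul, ← Finset.sum_neg_distrib]
    exact Finset.sum_congr rfl fun l _ => by ring

end KernelExistence

section Seminorms

variable {n : ℕ} {K : Set (EuclideanSpace ℝ (Fin n))} {f u : EuclideanSpace ℝ (Fin n) → ℝ}

theorem bddAbove_oscillations (hK : IsCompact K) (hf : ContinuousOn f K) (r : ℝ) :
    BddAbove {d : ℝ | ∃ x ∈ K, ∃ y ∈ K, 0 < dist x y ∧ dist x y ≤ r ∧ d = |f x - f y|} := by
  obtain ⟨M, hM⟩ := hK.exists_bound_of_continuousOn hf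
  refine ⟨M + M, ?_⟩
  rintro d ⟨x, hx, y, hy, -, -, rfl⟩
  exact (abs_sub _ _).trans (add_le_add (hM x hx) (hM y hy))

theorem domSemi_nonneg {ω : ℝ → ℝ} {R : ℝ} (hω : ∀ r ∈ Ioo 0 R, 0 < ω r) :
    0 ≤ domSemi K ω R f := by
  refine Real.sSup_nonneg ?_
  rintro c ⟨r, hr, rfl⟩
  refine div_nonneg (Real.sSup_nonneg ?_) (hω r hr).le
  rintro d ⟨x, -, y, -, -, -, rfl⟩
  exact abs_nonneg _

theorem MemD.abs_sub_le {ω : ℝ → ℝ} {R : ℝ} (hf : MemD K ω R f) (hK : IsCompact K)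
    (hω : ∀ r ∈ Ioo 0 R, 0 < ω r) {p q : EuclideanSpace ℝ (Fin n)} (hp : p ∈ K) (hq : q ∈ K)
    {r : ℝ} (hr : r ∈ Ioo 0 R) (hpq : dist p q ≤ r) : |f p - f q| ≤ domSemi K ω R f * ω r := by
  rcases eq_or_ne p q with rfl | hne
  · simpa using mul_nonneg (domSemi_nonneg hω) (hω r hr).le
  · have h1 : |f p - f q| ≤ oscf K f r :=
      le_csSup (bddAbove_oscillations hK hf.1 r) ⟨p, hp, q, hq, dist_pos.2 hne, hpq, rfl⟩
    have h2 : oscf K f r / ω r ≤ domSemi K ω R f := le_csSup hf.2 ⟨r, hr, rfl⟩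
    exact h1.trans ((div_le_iff₀ (hω r hr)).1 h2)

theorem memD_and_domSemi_le {h : ℝ → ℝ} {R N : ℝ} (hf : ContinuousOn f K)
    (hh : ∀ r ∈ Ioo 0 R, 0 < h r) (hmono : MonotoneOn h (Ioo 0 R)) (hN : 0 ≤ N)
    (hfN : ∀ x ∈ K, ∀ y ∈ K, x ≠ y → dist x y < R → |f x - f y| ≤ N * h (dist x y)) :
    MemD K h R f ∧ domSemi K h R f ≤ N := by
  have key : ∀ c ∈ semiSet K h R f, c ≤ N := by
    rintro c ⟨r, hr, rfl⟩
    rw [div_le_iff₀ (hh r hr)]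
    refine Real.sSup_le ?_ (mul_nonneg hN (hh r hr).le)
    rintro d ⟨x, hx, y, hy, h0, hxy, rfl⟩
    have hd : dist x y ∈ Ioo 0 R := ⟨h0, hxy.trans_lt hr.2⟩
    exact (hfN x hx y hy (dist_pos.1 h0) hd.2).trans
      (mul_le_mul_of_nonneg_left (hmono hd hr hxy) hN)
  exact ⟨⟨hf, N, key⟩, Real.sSup_le key hN⟩

theorem c2norm_nonneg : 0 ≤ c2norm K u := by
  refine Real.sSup_nonneg ?_
  rintro c ⟨x, -, rfl⟩
  positivity

theorem norm_fderiv_fderiv_le_c2norm {U : Set (EuclideanSpace ℝ (Fin n))} (hU : IsOpen U)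
    (hK : IsCompact K) (hKU : K ⊆ U) (hu : ContDiffOn ℝ 2 u U) {x : EuclideanSpace ℝ (Fin n)}
    (hx : x ∈ K) : ‖fderiv ℝ (fderiv ℝ u) x‖ ≤ c2norm K u := by
  have h1 : ContDiffOn ℝ 1 (fderiv ℝ u) U := hu.fderiv_of_isOpen hU (by norm_num)
  have h2 : ContinuousOn (fderiv ℝ (fderiv ℝ u)) U := h1.continuousOn_fderiv_of_isOpen hU le_rfl
  have h3 : ContinuousOn (fun x => |u x| + ‖fderiv ℝ u x‖ + ‖fderiv ℝ (fderiv ℝ u) x‖) K := by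
    have hu0 : ContinuousOn u K := hu.continuousOn.mono hKU
    have hu1 : ContinuousOn (fderiv ℝ u) K := h1.continuousOn.mono hKU
    have hu2 : ContinuousOn (fun x => ‖fderiv ℝ (fderiv ℝ u) x‖) K :=
      ContinuousOn.norm (f := fderiv ℝ (fderiv ℝ u)) (h2.mono hKU)
    exact (hu0.abs.fun_add hu1.norm).fun_add hu2
  obtain ⟨M, hM⟩ := hK.exists_bound_of_continuousOn h3
  have h4 : |u x| + ‖fderiv ℝ u x‖ + ‖fderiv ℝ (fderiv ℝ u) x‖ ≤ c2norm K u := by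
    refine le_csSup ⟨M, ?_⟩ ⟨x, hx, rfl⟩
    rintro c ⟨y, hy, rfl⟩
    exact (le_abs_self _).trans (hM y hy)
  refine le_trans ?_ h4
  have := abs_nonneg (u x)
  have := norm_nonneg (fderiv ℝ u x)
  linarith

theorem pd2_eq_fderiv_fderiv {x : EuclideanSpace ℝ (Fin n)} (hu : ContDiffAt ℝ 2 u x)
    (i j : Fin n) : pd2 u i j x =
      fderiv ℝ (fderiv ℝ u) x (EuclideanSpace.single i 1) (EuclideanSpace.single j 1) :=
  dirD_dirD_apply hu _ _

theorem abs_pd2_le_c2norm {U : Set (EuclideanSpace ℝ (Fin n))} (hU : IsOpen U)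
    (hK : IsCompact K) (hKU : K ⊆ U) (hu : ContDiffOn ℝ 2 u U) {x : EuclideanSpace ℝ (Fin n)}
    (hx : x ∈ K) (i j : Fin n) : |pd2 u i j x| ≤ c2norm K u := by
  rw [pd2_eq_fderiv_fderiv (hu.contDiffAt (hU.mem_nhds (hKU hx)))]
  refine le_trans ?_ (norm_fderiv_fderiv_le_c2norm hU hK hKU hu hx)
  simpa using (fderiv ℝ (fderiv ℝ u) x).le_opNorm₂ (EuclideanSpace.single i 1)
    (EuclideanSpace.single j 1)

theorem continuousOn_pd2 {U : Set (EuclideanSpace ℝ (Fin n))} (hU : IsOpen U)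
    (hu : ContDiffOn ℝ 2 u U) (i j : Fin n) : ContinuousOn (pd2 u i j) U := by
  have h1 : ContDiffOn ℝ 1 (fderiv ℝ u) U := hu.fderiv_of_isOpen hU (by norm_num)
  have h2 : ContinuousOn (fderiv ℝ (fderiv ℝ u)) U := h1.continuousOn_fderiv_of_isOpen hU le_rfl
  refine ContinuousOn.congr (f := fun x =>
    fderiv ℝ (fderiv ℝ u) x (EuclideanSpace.single i 1) (EuclideanSpace.single j 1))
    ((h2.clm_apply continuousOn_const).clm_apply continuousOn_const) fun x hx => ?_
  exact pd2_eq_fderiv_fderiv (hu.contDiffAt (hU.mem_nhds hx)) i j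

theorem pd2_congr {v : EuclideanSpace ℝ (Fin n) → ℝ} {x : EuclideanSpace ℝ (Fin n)}
    (h : v =ᶠ[𝓝 x] u) (i j : Fin n) : pd2 v i j x = pd2 u i j x := by
  have h1 : (fun y => fderiv ℝ v y (EuclideanSpace.single j 1)) =ᶠ[𝓝 x]
      fun y => fderiv ℝ u y (EuclideanSpace.single j 1) := by
    filter_upwards [h.fderiv (𝕜 := ℝ)] with y hy
    rw [hy]
  unfold pd2
  rw [h1.fderiv_eq]

theorem exists_contDiff_compactSupport_eq_near {U : Set (EuclideanSpace ℝ (Fin n))}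
    (hU : IsOpen U) (hu : ContDiffOn ℝ 2 u U) {r : ℝ} (hr : 0 < r) (hrU : closedBall 0 r ⊆ U) :
    ∃ v : EuclideanSpace ℝ (Fin n) → ℝ, ContDiff ℝ 2 v ∧ HasCompactSupport v ∧
      ∀ x ∈ closedBall 0 r, v =ᶠ[𝓝 x] u := by
  obtain ⟨δ, hδ, hδU⟩ := (isCompact_closedBall (0 : EuclideanSpace ℝ (Fin n))
    r).exists_cthickening_subset_open hU hrU
  rw [cthickening_closedBall hδ.le hr.le] at hδU
  let χ : ContDiffBump (0 : EuclideanSpace ℝ (Fin n)) :=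
    ⟨r + δ / 2, r + δ, by positivity, by linarith⟩
  have hχU : tsupport χ ⊆ U := by
    rw [χ.tsupport_eq]
    exact fun y hy => hδU (by rwa [add_comm δ r])
  refine ⟨fun x => χ x * u x, contDiff_iff_contDiffAt.2 fun x => ?_, χ.hasCompactSupport.mul_right,
    fun x hx => ?_⟩
  · by_cases hx : x ∈ tsupport χ
    · exact χ.contDiff.contDiffAt.mul (hu.contDiffAt (hU.mem_nhds (hχU hx)))
    · refine (contDiffAt_const (c := (0 : ℝ))).congr_of_eventuallyEq ?_
      filter_upwards [notMem_tsupport_iff_eventuallyEq.1 hx] with y hy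
      simp [hy]
  · have hx' : x ∈ ball (0 : EuclideanSpace ℝ (Fin n)) (r + δ / 2) :=
      closedBall_subset_ball (by linarith) hx
    filter_upwards [isOpen_ball.mem_nhds hx'] with y hy
    rw [χ.one_of_mem_closedBall (ball_subset_closedBall hy), one_mul]

end Seminorms

section Modulus

variable {ω : ℝ → ℝ} {R : ℝ}

theorem IsOsc.exists_linear_lower_bound (hω : IsOsc ω R) (hR : 0 < R)
    (hinf : Tendsto (fun r => ω r / r) (𝓝[>] 0) atTop) :
    ∃ κ > 0, ∀ s ∈ Ioc 0 R, κ * s ≤ ω s := by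
  obtain ⟨δ, hδ, hδ'⟩ := mem_nhdsGT_iff_exists_Ioc_subset.1 (hinf.eventually_ge_atTop 1)
  have hδ0 : 0 < δ := hδ
  set d := min δ R
  have hd0 : 0 < d := lt_min hδ0 hR
  have hsmall (s) (hs : s ∈ Ioc 0 d) : s ≤ ω s := by
    have : 1 ≤ ω s / s := hδ' ⟨hs.1, hs.2.trans (min_le_left _ _)⟩
    rwa [le_div_iff₀ hs.1, one_mul] at this
  refine ⟨d / R, by positivity, fun s hs => ?_⟩
  have hdR : d / R ≤ 1 := (div_le_one hR).2 (min_le_right _ _)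
  rcases le_or_gt s d with h | h
  · have := hsmall s ⟨hs.1, h⟩
    nlinarith [hs.1]
  · have h1 := hsmall d ⟨hd0, le_rfl⟩
    have h2 := hω.mono ⟨hd0.le, min_le_right _ _⟩ ⟨hs.1.le, hs.2⟩ h.le
    have h3 : d / R * s ≤ d := by
      rw [div_mul_eq_mul_div, div_le_iff₀ hR]
      exact mul_le_mul_of_nonneg_left hs.2 hd0.le
    linarith

theorem intervalIntegrable_of_integrableOn_Ioc {f : ℝ → ℝ} (hf : IntegrableOn f (Ioc 0 R))
    {r : ℝ} (hr : r ∈ Icc 0 R) : IntervalIntegrable f volume 0 r :=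
  (intervalIntegrable_iff_integrableOn_Ioc_of_le hr.1).2 (hf.mono_set (Ioc_subset_Ioc_right hr.2))

theorem mul_le_integral_div {κ : ℝ} (hκ : ∀ s ∈ Ioc 0 R, κ * s ≤ ω s)
    (hdini : IntegrableOn (fun s => ω s / s) (Ioc 0 R)) {r : ℝ} (hr : r ∈ Icc 0 R) :
    κ * r ≤ ∫ s in (0 : ℝ)..r, ω s / s := by
  have h := intervalIntegral.integral_mono_on_of_le_Ioo (f := fun _ => κ) hr.1
    intervalIntegrable_const (intervalIntegrable_of_integrableOn_Ioc hdini hr) fun s hs => by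
      rw [le_div_iff₀ hs.1]
      exact hκ s ⟨hs.1, hs.2.le.trans hr.2⟩
  simpa [mul_comm] using h

theorem IsOsc.monotoneOn_integral_div_s14 (hω : IsOsc ω R)
    (hdini : IntegrableOn (fun s => ω s / s) (Ioc 0 R)) :
    MonotoneOn (fun r => ∫ s in (0 : ℝ)..r, ω s / s) (Ioo 0 R) := by
  intro r hr t ht hrt
  refine intervalIntegral.integral_mono_interval le_rfl hr.1.le hrt ?_
    (intervalIntegrable_of_integrableOn_Ioc hdini ⟨ht.1.le, ht.2.le⟩)
  filter_upwards [ae_restrict_mem measurableSet_Ioc] with s hs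
  exact div_nonneg (hω.pos s hs.1 (hs.2.trans ht.2.le)).le hs.1.le

end Modulus

theorem exists_pd2_modulus_bound {n : ℕ} {a : Fin n → Fin n → ℝ} (hsymm : ∀ i j, a i j = a j i)
    {ν : ℝ} (hν : 0 < ν)
    (hell : ∀ ξ : EuclideanSpace ℝ (Fin n), ν * ‖ξ‖ ^ 2 ≤ ∑ i, ∑ j, a i j * ξ i * ξ j)
    {R : ℝ} (hR : 0 < R) {ω : ℝ → ℝ} (hω : IsOsc ω R)
    (hdini : IntegrableOn (fun s => ω s / s) (Set.Ioc 0 R))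
    (hinf : Tendsto (fun r => ω r / r) (𝓝[>] 0) atTop) {C₂ δ₂ : ℝ} (hδ₂ : 0 < δ₂)
    (hB : ∀ r ∈ Set.Ioo (0 : ℝ) δ₂,
      (r * ∫ s in r..R, ω s / s ^ 2) / (∫ s in (0 : ℝ)..r, ω s / s) ≤ C₂) (i j : Fin n) :
    ∃ C c : ℝ, 0 ≤ C ∧ 0 ≤ c ∧ ∀ ρ : ℝ, 0 < ρ → ρ < 1 / 2 →
      ∀ (u : EuclideanSpace ℝ (Fin n) → ℝ) (U : Set (EuclideanSpace ℝ (Fin n))),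
        IsOpen U → closedBall 0 (2 * ρ) ⊆ U → ContDiffOn ℝ 2 u U →
        MemD (closedBall 0 (2 * ρ)) ω R (fun x => ∑ i, ∑ j, a i j * pd2 u i j x) →
        ∀ x ∈ closedBall 0 ρ, ∀ y ∈ closedBall 0 ρ, x ≠ y → dist x y < R →
          |pd2 u i j x - pd2 u i j y| ≤
            (C * domSemi (closedBall 0 (2 * ρ)) ω R (fun x => ∑ i, ∑ j, a i j * pd2 u i j x) +
              (c / ρ ^ 3) * c2norm (closedBall 0 (2 * ρ)) u) *
                ∫ s in (0 : ℝ)..dist x y, ω s / s := by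
  obtain ⟨φ, ψ, hker⟩ := exists_isKernelPair hν hsymm hell
  obtain ⟨κ, hκ0, hκ⟩ := hω.exists_linear_lower_bound hR hinf
  obtain ⟨ℓφ, hℓφ⟩ := (hker.smooth_fst).lipschitzWith_of_hasCompactSupport
    (hasCompactSupport_of_lt_norm hker.fst_eq_zero) (by simp)
  obtain ⟨ℓψ, hℓψ⟩ := (((hker.smooth_snd).dirD (k := 2) (by simp)
    (EuclideanSpace.single i 1)).dirD (k := 1) (m := 2) (by norm_num)
      (EuclideanSpace.single j 1)).lipschitzWith_of_hasCompactSupport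
    (((hasCompactSupport_of_lt_norm hker.snd_eq_zero).dirD _).dirD _) (by simp)
  set V := volume.real (closedBall (0 : EuclideanSpace ℝ (Fin n)) 1)
  have hV : 0 ≤ V := measureReal_nonneg
  set I := ∫ z, |dirD (EuclideanSpace.single j 1) (dirD (EuclideanSpace.single i 1) ψ) z|
  have hI : 0 ≤ I := integral_nonneg fun z => abs_nonneg _
  set m := min 1 R
  have hm : 0 < m := lt_min one_pos hR
  set d := min δ₂ (m / 2)
  have hd : 0 < d := lt_min hδ₂ (by positivity)
  refine ⟨2 * I + ℓψ * V * |C₂|, ℓφ * V / (m * κ) + 2 / (d * κ), by positivity, by positivity,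
    fun ρ hρ hρ2 u U hU hKU hu hLu x hx y hy hxy hxyR => ?_⟩
  set K : Set (EuclideanSpace ℝ (Fin n)) := closedBall 0 (2 * ρ)
  have hK : IsCompact K := isCompact_closedBall _ _
  set r := dist x y
  have hr : 0 < r := dist_pos.2 hxy
  set S := domSemi K ω R (fun x => ∑ i, ∑ j, a i j * pd2 u i j x)
  set M := c2norm K u
  set W := ∫ s in (0 : ℝ)..r, ω s / s
  have hωpos : ∀ r ∈ Ioo 0 R, 0 < ω r := fun r hr => hω.pos r hr.1 hr.2.le
  have hS : 0 ≤ S := domSemi_nonneg hωpos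
  have hM : 0 ≤ M := c2norm_nonneg
  have hW : κ * r ≤ W := mul_le_integral_div hκ hdini ⟨hr.le, hxyR.le⟩
  have hW0 : 0 < W := lt_of_lt_of_le (by positivity) hW
  have hrW : r ≤ W / κ := by rwa [le_div_iff₀ hκ0, mul_comm]
  have hρ3 : 1 / ρ ≤ 1 / ρ ^ 3 := by
    refine one_div_le_one_div_of_le (by positivity) ?_
    have : ρ ^ 2 ≤ 1 := by nlinarith
    nlinarith
  have hball (w) (hw : w ∈ closedBall (0 : EuclideanSpace ℝ (Fin n)) ρ) {T : ℝ} (hT : T ≤ ρ) :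
      closedBall w T ⊆ K := by
    refine closedBall_subset_closedBall' ?_
    have := mem_closedBall.1 hw
    linarith
  have hbound (p) (hp : p ∈ K) : |pd2 u i j p| ≤ M := abs_pd2_le_c2norm hU hK hKU hu hp i j
  by_cases hcase : r < δ₂ ∧ 2 * r ≤ ρ * m
  · obtain ⟨v, hv, hvc, hvu⟩ := exists_contDiff_compactSupport_eq_near hU hu
      (r := 2 * ρ) (by positivity) hKU
    have hpd (k l : Fin n) (p) (hp : p ∈ K) : dirD (EuclideanSpace.single k 1)
        (dirD (EuclideanSpace.single l 1) v) p = pd2 u k l p := pd2_congr (hvu p hp) k l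
    have hTρ : ρ * m ≤ ρ := mul_le_of_le_one_right hρ.le (min_le_left _ _)
    have hTR : ρ * m < R := by
      have : m ≤ R := min_le_right _ _
      nlinarith
    have hxK := hball x hx hTρ
    have hyK := hball y hy hTρ
    have hT0 : 0 ≤ ρ * m := by positivity
    have key := hker.abs_dirD_dirD_sub_le hv hvc i j hℓφ hℓψ hω hdini hxy hcase.2 hTR hxK hyK
      (M := M) (S := S) (fun p hp => by rw [hpd _ _ p hp]; exact hbound p hp)
      fun p hp q hq τ hτ hpq => by
        simp only [hpd _ _ p hp, hpd _ _ q hq]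
        exact hLu.abs_sub_le hK hωpos hp hq hτ hpq
    rw [hpd _ _ x (hxK (mem_closedBall_self hT0)), hpd _ _ y (hyK (mem_closedBall_self hT0))] at key
    have h1 : r * ∫ s in r..R, ω s / s ^ 2 ≤ |C₂| * W :=
      (div_le_iff₀ hW0).1 ((hB r ⟨hr, hcase.1⟩).trans (le_abs_self _))
    have h2 : r / (ρ * m) ≤ 1 / ρ ^ 3 * (W / (m * κ)) := by
      calc r / (ρ * m) = 1 / ρ * (r / m) := by field_simp
        _ ≤ 1 / ρ ^ 3 * (W / κ / m) := by gcongr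
        _ = 1 / ρ ^ 3 * (W / (m * κ)) := by field_simp
    refine key.trans ?_
    calc S * (2 * I) * W + S * ℓψ * V * (r * ∫ s in r..R, ω s / s ^ 2) +
          M * ℓφ * V * (r / (ρ * m))
        ≤ S * (2 * I) * W + S * ℓψ * V * (|C₂| * W) +
          M * ℓφ * V * (1 / ρ ^ 3 * (W / (m * κ))) + 2 / (d * κ) / ρ ^ 3 * M * W := by
          have : 0 ≤ 2 / (d * κ) / ρ ^ 3 * M * W := by positivity
          have : S * ℓψ * V * (r * ∫ s in r..R, ω s / s ^ 2) ≤ S * ℓψ * V * (|C₂| * W) := by gcongr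
          have : M * ℓφ * V * (r / (ρ * m)) ≤ M * ℓφ * V * (1 / ρ ^ 3 * (W / (m * κ))) := by gcongr
          linarith
      _ = _ := by
        field_simp
        ring
  · have hrd : ρ * d ≤ r := by
      rw [not_and_or, not_lt, not_le] at hcase
      rcases hcase with h | h
      · have : d ≤ δ₂ := min_le_left _ _
        nlinarith
      · have : d ≤ m / 2 := min_le_right _ _
        nlinarith
    have h1 : |pd2 u i j x - pd2 u i j y| ≤ 2 * M := by
      rw [two_mul]
      exact (abs_sub _ _).trans (add_le_add
        (hbound x (hball x hx le_rfl (mem_closedBall_self hρ.le)))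
        (hbound y (hball y hy le_rfl (mem_closedBall_self hρ.le))))
    have h2 : 1 ≤ 1 / ρ ^ 3 * (W / (d * κ)) := by
      calc (1 : ℝ) ≤ r / (ρ * d) := (one_le_div (by positivity)).2 hrd
        _ = 1 / ρ * (r / d) := by field_simp
        _ ≤ 1 / ρ ^ 3 * (W / κ / d) := by gcongr
        _ = 1 / ρ ^ 3 * (W / (d * κ)) := by field_simp
    calc |pd2 u i j x - pd2 u i j y| ≤ 2 * M * 1 := by rwa [mul_one]
      _ ≤ 2 * M * (1 / ρ ^ 3 * (W / (d * κ))) := by gcongr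
      _ ≤ 2 * M * (1 / ρ ^ 3 * (W / (d * κ))) + ((2 * I + ℓψ * V * |C₂|) * S * W +
            ℓφ * V / (m * κ) / ρ ^ 3 * M * W) := le_add_of_nonneg_right (by positivity)
      _ = _ := by
        field_simp
        ring

/-- Interior estimate, constant coefficients: for `L = Σ aᵢⱼ ∂ᵢ∂ⱼ` uniformly elliptic with
constant symmetric coefficients, if `u` is twice continuously differentiable on a
neighbourhood of `I(2ρ)` and `Lu ∈ D_ω(I(2ρ))`, then `∇²u ∈ D_ĥ(I(ρ))` and
`[∇²u]_{ĥ;ρ} ≤ C [Lu]_{ω;2ρ} + (c/ρ³) ‖u‖_{C²(I(2ρ))}`, with `C, c` independent of `ρ`. -/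
theorem interior_estimate_const_coeff {n : ℕ} (hn : 3 ≤ n)
    (a : Fin n → Fin n → ℝ) (hsymm : ∀ i j, a i j = a j i)
    (ν : ℝ) (hν : 0 < ν)
    (hell : ∀ ξ : EuclideanSpace ℝ (Fin n), ν * ‖ξ‖ ^ 2 ≤ ∑ i, ∑ j, a i j * ξ i * ξ j)
    (R : ℝ) (hR : 0 < R) (ω : ℝ → ℝ) (hω : IsOsc ω R)
    (hdini : IntegrableOn (fun s => ω s / s) (Set.Ioc 0 R))
    (hinf : Filter.Tendsto (fun r => ω r / r) (nhdsWithin 0 (Set.Ioi 0)) Filter.atTop)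
    (k₁ c₁ δ₁ : ℝ) (hk₁ : 1 < k₁) (hc₁ : 0 < c₁) (hδ₁ : 0 < δ₁) (hδ₁R : k₁ * δ₁ ≤ R)
    (hdbl : ∀ r ∈ Set.Ioo (0:ℝ) δ₁, ω (k₁ * r) ≤ c₁ * ω r)
    (C₂ δ₂ : ℝ) (hδ₂ : 0 < δ₂)
    (hB : ∀ r ∈ Set.Ioo (0:ℝ) δ₂,
      (r * ∫ s in r..R, ω s / s ^ 2) / (∫ s in (0:ℝ)..r, ω s / s) ≤ C₂) :
    ∃ C c : ℝ, 0 < C ∧ 0 < c ∧ ∀ ρ : ℝ, 0 < ρ → ρ < 1 / 2 →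
      ∀ (u : EuclideanSpace ℝ (Fin n) → ℝ) (U : Set (EuclideanSpace ℝ (Fin n))),
        IsOpen U → Metric.closedBall 0 (2 * ρ) ⊆ U → ContDiffOn ℝ 2 u U →
        MemD (Metric.closedBall 0 (2 * ρ)) ω R
          (fun x => ∑ i, ∑ j, a i j * pd2 u i j x) →
        ∀ i j : Fin n,
          MemD (Metric.closedBall 0 ρ) (fun r => ∫ s in (0:ℝ)..r, ω s / s) R (pd2 u i j) ∧
          domSemi (Metric.closedBall 0 ρ) (fun r => ∫ s in (0:ℝ)..r, ω s / s) R
              (pd2 u i j) ≤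
            C * domSemi (Metric.closedBall 0 (2 * ρ)) ω R
                (fun x => ∑ i, ∑ j, a i j * pd2 u i j x) +
              (c / ρ ^ 3) * c2norm (Metric.closedBall 0 (2 * ρ)) u := by
  choose C c hC hc hest using
    exists_pd2_modulus_bound hsymm hν hell hR hω hdini hinf hδ₂ hB
  refine ⟨1 + ∑ i, ∑ j, C i j, 1 + ∑ i, ∑ j, c i j,
    add_pos_of_pos_of_nonneg one_pos
      (Finset.sum_nonneg fun i _ => Finset.sum_nonneg fun j _ => hC i j),
    add_pos_of_pos_of_nonneg one_pos
      (Finset.sum_nonneg fun i _ => Finset.sum_nonneg fun j _ => hc i j),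
    fun ρ hρ hρ2 u U hU hKU hu hLu i j => ?_⟩
  have hle {b : Fin n → Fin n → ℝ} (hb : ∀ i j, 0 ≤ b i j) : b i j ≤ 1 + ∑ i, ∑ j, b i j := by
    have h1 := Finset.single_le_sum (fun l _ => hb i l) (Finset.mem_univ j)
    have h2 := Finset.single_le_sum (f := fun k => ∑ l, b k l)
      (fun k _ => Finset.sum_nonneg fun l _ => hb k l) (Finset.mem_univ i)
    linarith
  have hωpos : ∀ r ∈ Ioo 0 R, 0 < ω r := fun r hr => hω.pos r hr.1 hr.2.le
  obtain ⟨κ, hκ0, hκ⟩ := hω.exists_linear_lower_bound hR hinf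
  have hhat : ∀ r ∈ Ioo 0 R, 0 < ∫ s in (0 : ℝ)..r, ω s / s := fun r hr =>
    (mul_pos hκ0 hr.1).trans_le (mul_le_integral_div hκ hdini ⟨hr.1.le, hr.2.le⟩)
  have hS := domSemi_nonneg (K := closedBall 0 (2 * ρ))
    (f := fun x => ∑ i, ∑ j, a i j * pd2 u i j x) hωpos
  have hM := c2norm_nonneg (K := closedBall 0 (2 * ρ)) (u := u)
  have hsub : closedBall 0 ρ ⊆ U := (closedBall_subset_closedBall (by linarith)).trans hKU
  have hC' := hle hC
  have hc' := hle hc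
  refine memD_and_domSemi_le ((continuousOn_pd2 hU hu i j).mono hsub) hhat
    (hω.monotoneOn_integral_div_s14 hdini) ?_ fun x hx y hy hxy hxyR => ?_
  · have := (hC i j).trans hC'
    have := (hc i j).trans hc'
    positivity
  · refine (hest i j ρ hρ hρ2 u U hU hKU hu hLu x hx y hy hxy hxyR).trans ?_
    have := (hhat _ ⟨dist_pos.2 hxy, hxyR⟩).le
    gcongr
end
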